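/- arXiv:2304.10106 — 9 statements merged into one kernel-verified Lean document; each statement's English description precedes it below -/
import Mathlib

section
/- Weighted Cheeger inequality. Let (G,w) be a weighted graph that is a λ-spectral expander, i.e. for every f : V → ℝ with ⟨f,𝟙⟩_w = 0 one has ⟨Af,f⟩_w ≤ λ·⟨f,f⟩_w. Then for every subset A ⊆ V, the total weight of edges with exactly one endpoint in A satisfies ∑_{e∈E, |e∩A|=1} w(e) ≥ 2(1−λ)·w(A)·(1−w(A)), where w(A) = ∑_{v∈A} w(v). -/
open Finset

theorem sum_vertexWeight_mul {V : Type*} [Fintype V] [DecidableEq V]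
    (E : Finset (Finset V)) (w : Finset V → ℝ) (wV : V → ℝ)
    (hwV : ∀ v : V, wV v = (1 / 2) * ∑ e ∈ E.filter (fun e => v ∈ e), w e) (g : V → ℝ) :
    ∑ v, wV v * g v = ∑ e ∈ E, w e / 2 * ∑ v ∈ e, g v := by
  calc ∑ v, wV v * g v = ∑ v, ∑ e ∈ E, if v ∈ e then w e / 2 * g v else 0 := by
        refine Finset.sum_congr rfl fun v _ => ?_
        rw [hwV, Finset.mul_sum, Finset.sum_mul, Finset.sum_filter]
        refine Finset.sum_congr rfl fun e _ => ?_
        split_ifs <;> ring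
    _ = _ := by
        rw [Finset.sum_comm]
        refine Finset.sum_congr rfl fun e _ => ?_
        rw [Finset.mul_sum, ← Finset.sum_filter]
        congr 1
        ext v
        simp

theorem sum_ite_pair_eq {V : Type*} [Fintype V] [DecidableEq V] {a b : V} (hab : a ≠ b)
    (F : V → V → ℝ) :
    (∑ v, ∑ u, if ({v, u} : Finset V) = {a, b} then F v u else 0) = F a b + F b a := by
  have hne : ((a, b) : V × V) ≠ (b, a) := by
    simp [hab]
  rw [← Fintype.sum_prod_type' (f := fun v u => if ({v, u} : Finset V) = {a, b} then F v u else 0),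
    ← Finset.sum_filter, ← Finset.sum_pair (f := fun p : V × V => F p.1 p.2) hne]
  congr 1
  ext ⟨v, u⟩
  simp only [Finset.mem_filter, Finset.mem_univ, true_and, Finset.mem_insert,
    Finset.mem_singleton, Prod.mk.injEq]
  rw [← Finset.coe_inj]
  push_cast
  exact Set.pair_eq_pair_iff

theorem sum_adjacent_pairs {V : Type*} [Fintype V] [DecidableEq V]
    (E : Finset (Finset V)) (w : Finset V → ℝ) (F : V → V → ℝ) :
    (∑ v, ∑ u ∈ Finset.univ.filter (fun u => ({v, u} : Finset V) ∈ E), w {v, u} * F v u) =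
      ∑ e ∈ E, w e * ∑ v, ∑ u, if ({v, u} : Finset V) = e then F v u else 0 := by
  simp only [Finset.mul_sum, Finset.sum_filter]
  rw [Finset.sum_comm (s := E)]
  refine Finset.sum_congr rfl fun v _ => ?_
  rw [Finset.sum_comm (s := E)]
  refine Finset.sum_congr rfl fun u _ => ?_
  simp only [mul_ite, mul_zero, Finset.sum_ite_eq]

theorem edge_energy_indicator {V : Type*} [DecidableEq V] (S : Finset V) (p : ℝ) {a b : V}
    (hab : a ≠ b) :
    (((if a ∈ S then 1 else 0) - p) - ((if b ∈ S then 1 else 0) - p)) ^ 2 =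
      if (({a, b} : Finset V) ∩ S).card = 1 then (1 : ℝ) else 0 := by
  rw [sub_sub_sub_cancel_right]
  by_cases ha : a ∈ S <;> by_cases hb : b ∈ S <;>
    simp [ha, hb, hab, Finset.insert_inter_of_mem, Finset.insert_inter_of_notMem,
      Finset.singleton_inter_of_mem, Finset.singleton_inter_of_notMem]

/-- **Weighted Cheeger inequality.** If the weighted graph `(G,w)` is a
`λ`-spectral expander (every function orthogonal to constants satisfies the Rayleigh
quotient bound), then for every vertex subset `S` the total weight of edges with exactly
one endpoint in `S` is at least `2(1-λ)·w(S)·(1-w(S))`. -/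
theorem weighted_cheeger_inequality {V : Type*} [Fintype V] [DecidableEq V]
    (E : Finset (Finset V))
    (hE_card : ∀ e ∈ E, e.card = 2)
    (hno_iso : ∀ v : V, ∃ e ∈ E, v ∈ e)
    (w : Finset V → ℝ)
    (hw_pos : ∀ e ∈ E, 0 < w e)
    (hw_le : ∀ e ∈ E, w e ≤ 1)
    (hw_sum : ∑ e ∈ E, w e = 1)
    (wV : V → ℝ)
    (hwV : ∀ v : V, wV v = (1 / 2) * ∑ e ∈ E.filter (fun e => v ∈ e), w e)
    (A : (V → ℝ) → V → ℝ)
    (hA : ∀ (f : V → ℝ) (v : V), A f v =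
      ∑ u ∈ Finset.univ.filter (fun u => ({v, u} : Finset V) ∈ E),
        (w {v, u} / (2 * wV v)) * f u)
    (lam : ℝ)
    (hexp : ∀ f : V → ℝ, (∑ v, wV v * f v) = 0 →
      ∑ v, wV v * A f v * f v ≤ lam * ∑ v, wV v * f v * f v)
    (S : Finset V) :
    ∑ e ∈ E.filter (fun e => (e ∩ S).card = 1), w e ≥
      2 * (1 - lam) * (∑ v ∈ S, wV v) * (1 - ∑ v ∈ S, wV v) := by
  have hpos : ∀ v, 0 < wV v := fun v => by
    obtain ⟨e, he, hve⟩ := hno_iso v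
    rw [hwV]
    have : 0 < ∑ e ∈ E.filter (fun e => v ∈ e), w e :=
      Finset.sum_pos (fun e he => hw_pos e (Finset.mem_filter.1 he).1)
        ⟨e, Finset.mem_filter.2 ⟨he, hve⟩⟩
    positivity
  have htotal : ∑ v, wV v = 1 := by
    have h := sum_vertexWeight_mul E w wV hwV (fun _ => 1)
    simp only [mul_one] at h
    rw [h]
    refine (Finset.sum_congr rfl fun e he => ?_).trans hw_sum
    simp [hE_card e he]
  set p := ∑ v ∈ S, wV v with hp
  let f : V → ℝ := fun v => (if v ∈ S then 1 else 0) - p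
  have hindicator : ∑ v, wV v * (if v ∈ S then 1 else 0) = p := by
    simp [hp]
  have hmean : ∑ v, wV v * f v = 0 := by
    simp only [f, mul_sub, Finset.sum_sub_distrib, ← Finset.sum_mul, htotal, hindicator]
    ring
  have hnorm : ∑ v, wV v * f v * f v = p * (1 - p) := by
    calc ∑ v, wV v * f v * f v
        = ∑ v, ((1 - 2 * p) * (wV v * (if v ∈ S then 1 else 0)) + p ^ 2 * wV v) := by
          refine Finset.sum_congr rfl fun v _ => ?_
          simp only [f]
          split_ifs <;> ring
      _ = p * (1 - p) := by
          rw [Finset.sum_add_distrib, ← Finset.mul_sum, ← Finset.mul_sum, htotal, hindicator]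
          ring
  have hadj : ∑ v, wV v * A f v * f v =
      1 / 2 * ∑ e ∈ E, w e * ∑ v, ∑ u, if ({v, u} : Finset V) = e then f u * f v else 0 := by
    rw [← sum_adjacent_pairs E w (fun v u => f u * f v), Finset.mul_sum]
    refine Finset.sum_congr rfl fun v _ => ?_
    rw [hA, Finset.mul_sum, Finset.sum_mul, Finset.mul_sum]
    refine Finset.sum_congr rfl fun u _ => ?_
    have := (hpos v).ne'
    field_simp
  have henergy : ∑ v, wV v * f v * f v - ∑ v, wV v * A f v * f v =
      1 / 2 * ∑ e ∈ E.filter (fun e => (e ∩ S).card = 1), w e := by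
    rw [hadj, Finset.sum_congr rfl fun v _ => mul_assoc (wV v) (f v) (f v), sum_vertexWeight_mul E w wV hwV (fun v => f v * f v), Finset.sum_filter,
      Finset.mul_sum, Finset.mul_sum, ← Finset.sum_sub_distrib]
    refine Finset.sum_congr rfl fun e he => ?_
    obtain ⟨a, b, hab, rfl⟩ := Finset.card_eq_two.1 (hE_card e he)
    rw [sum_ite_pair_eq hab (fun v u => f u * f v), Finset.sum_pair hab]
    have h := edge_energy_indicator S p hab
    change (f a - f b) ^ 2 = _ at h
    calc _ = w {a, b} / 2 * (f a - f b) ^ 2 := by ring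
      _ = _ := by
        rw [h]
        split_ifs <;> ring
  have h := hexp f hmean
  rw [hnorm] at h henergy
  linarith
end

section
/- Converse Cheeger inequality (Friedland–Nabben). Let (G,w) be a weighted graph and let 0 ≤ ε ≤ 2 be such that for every nonempty proper subset S ⊊ V, ∑_{e∈E, |e∩S|=1} w(e) ≥ ε·min( w(S), w(V∖S) ), where w(S) = ∑_{v∈S} w(v). Then (G,w) is a √(1−ε²/4)-spectral expander: for every f : V → ℝ with ⟨f,𝟙⟩_w = 0 one has ⟨Af,f⟩_w ≤ √(1−ε²/4)·⟨f,f⟩_w. -/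
open Finset

section Cheeger

variable {V : Type*} [Fintype V]

lemma sum_mul_add_sq (a : V → V → ℝ) (hsymm : ∀ u v, a u v = a v u) (x : V → ℝ) (s : ℝ) :
    ∑ u, ∑ v, a u v * (x u + s * x v) ^ 2 =
      (1 + s ^ 2) * ∑ u, (∑ v, a u v) * x u ^ 2 + 2 * s * ∑ u, ∑ v, a u v * (x u * x v) := by
  have h1 : ∑ u, (∑ v, a u v) * x u ^ 2 = ∑ u, ∑ v, a u v * x u ^ 2 := by simp only [sum_mul]
  have h2 : ∑ u, ∑ v, a u v * x u ^ 2 = ∑ u, ∑ v, a u v * x v ^ 2 := by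
    rw [sum_comm]
    exact sum_congr rfl fun u _ => sum_congr rfl fun v _ => by rw [hsymm]
  rw [add_mul, h1, one_mul]
  nth_rewrite 2 [h2]
  simp only [mul_sum, ← sum_add_distrib]
  exact sum_congr rfl fun u _ => sum_congr rfl fun v _ => by ring

variable [DecidableEq V]

/-- Discrete co-area inequality: an isoperimetric bound for the indicator functions of the subsets
of `T` extends to all nonnegative functions supported in `T`. -/
lemma mul_sum_le_sum_abs_sub_of_indicator (a : V → V → ℝ) (d : V → ℝ) (ε : ℝ) (T : Finset V)
    (h : ∀ S ⊆ T, ε * ∑ v ∈ S, d v ≤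
      ∑ u, ∑ v, a u v * |(if u ∈ S then (1 : ℝ) else 0) - (if v ∈ S then (1 : ℝ) else 0)|)
    (y : V → ℝ) (hy : ∀ v, 0 ≤ y v) (hyT : ∀ v, y v ≠ 0 → v ∈ T) :
    ε * ∑ v, d v * y v ≤ ∑ u, ∑ v, a u v * |y u - y v| := by
  induction hn : (univ.filter (fun v => y v ≠ 0)).card using Nat.strong_induction_on
    generalizing y with
  | _ n ih =>
    set S := univ.filter (fun v => y v ≠ 0) with hS
    have memS : ∀ v, v ∈ S ↔ y v ≠ 0 := fun v => by simp [hS]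
    rcases S.eq_empty_or_nonempty with h0 | hne
    · have hz : ∀ v, y v = 0 := fun v => by
        by_contra hv
        have := (memS v).2 hv
        simp [h0] at this
      simp [hz]
    · obtain ⟨z, hzS, hz⟩ := S.exists_min_image y hne
      have hz0 : 0 ≤ y z := hy z
      set χ : V → ℝ := fun v => if v ∈ S then 1 else 0 with hχ
      have hχ1 : ∀ v ∈ S, χ v = 1 := fun v hv => by simp [hχ, hv]
      have hχ0 : ∀ v, v ∉ S → χ v = 0 := fun v hv => by simp [hχ, hv]
      have hyS : ∀ v, v ∉ S → y v = 0 := fun v hv => by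
        by_contra h'
        exact hv ((memS v).2 h')
      have key := ih _ ?_ (fun v => y v - y z * χ v) ?_ ?_ rfl
      · have hsub : ∀ u v, |y u - y v| =
            y z * |χ u - χ v| + |(y u - y z * χ u) - (y v - y z * χ v)| := by
          intro u v
          by_cases hu : u ∈ S <;> by_cases hv : v ∈ S
          · simp [hχ1 u hu, hχ1 v hv]
          · have := hz u hu
            simp [hχ1 u hu, hχ0 v hv, hyS v hv, abs_of_nonneg (hy u),
              abs_of_nonneg (sub_nonneg.2 this)]
          · have := hz v hv
            simp only [hχ1 v hv, hχ0 u hu, hyS u hu]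
            rw [abs_of_nonpos (by linarith [hy v]), abs_of_nonpos (by linarith),
              abs_of_nonpos (by linarith)]
            ring
          · simp [hχ0 u hu, hχ0 v hv, hyS u hu, hyS v hv]
        have hS' := h S (fun v hv => hyT v ((memS v).1 hv))
        have h1 : ∑ v, d v * y v = y z * ∑ v ∈ S, d v + ∑ v, d v * (y v - y z * χ v) := by
          have : ∑ v ∈ S, d v = ∑ v, d v * χ v := by simp [hχ]
          rw [this, mul_sum, ← sum_add_distrib]
          exact sum_congr rfl fun v _ => by ring
        have h2 : ∑ u, ∑ v, a u v * |y u - y v| = y z * ∑ u, ∑ v, a u v * |χ u - χ v| +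
            ∑ u, ∑ v, a u v * |(y u - y z * χ u) - (y v - y z * χ v)| := by
          simp only [mul_sum, ← sum_add_distrib]
          exact sum_congr rfl fun u _ => sum_congr rfl fun v _ => by rw [hsub]; ring
        rw [h1, h2]
        have := mul_le_mul_of_nonneg_left hS' hz0
        linarith
      · rw [← hn]
        refine card_lt_card ⟨fun v hv => ?_, fun hss => ?_⟩
        · by_contra hvS
          simp [hχ0 v hvS, hyS v hvS] at hv
        · have := hss hzS
          simp [hχ1 z hzS] at this
      · intro v
        by_cases hv : v ∈ S
        · simpa [hχ1 v hv] using hz v hv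
        · simp [hχ0 v hv, hyS v hv]
      · intro v hv
        refine hyT v fun h' => hv ?_
        have : v ∉ S := fun hvS => (memS v).1 hvS h'
        simp [hχ0 v this, h']

/-- Every real function on a finite type has a weighted median. -/
lemma exists_weighted_median [Nonempty V] (d : V → ℝ) (hd : ∀ v, 0 ≤ d v) (f : V → ℝ) :
    ∃ c, 2 * ∑ v with c < f v, d v ≤ ∑ v, d v ∧ 2 * ∑ v with f v < c, d v ≤ ∑ v, d v := by
  have hD : 0 ≤ ∑ v, d v := sum_nonneg fun v _ => hd v
  obtain ⟨t, -, ht⟩ := univ.exists_max_image f univ_nonempty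
  let B : Finset V := univ.filter (fun z => 2 * ∑ v with f z < f v, d v ≤ ∑ v, d v)
  have hB : B.Nonempty := by
    refine ⟨t, mem_filter.2 ⟨mem_univ _, ?_⟩⟩
    rw [filter_false_of_mem fun v _ => not_lt.2 (ht v (mem_univ v))]
    simpa using hD
  obtain ⟨z, hzB, hz⟩ := B.exists_min_image f hB
  refine ⟨f z, (mem_filter.1 hzB).2, ?_⟩
  rcases (univ.filter (fun v => f v < f z)).eq_empty_or_nonempty with h0 | hne
  · rw [h0]; simpa using hD
  obtain ⟨p, hp, hpm⟩ := exists_max_image _ f hne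
  have hpB : p ∉ B := fun h => not_lt.2 (hz p h) (mem_filter.1 hp).2
  have hp' : ∑ v, d v < 2 * ∑ v with f p < f v, d v := by simpa [B] using hpB
  have hdis : Disjoint (univ.filter (fun v => f v < f z)) (univ.filter (fun v => f p < f v)) :=
    disjoint_left.2 fun v hv hv' => not_lt.2 (hpm v hv) (mem_filter.1 hv').2
  have := sum_le_sum_of_subset_of_nonneg (f := d)
    (subset_univ ((univ.filter (fun v => f v < f z)) ∪ (univ.filter (fun v => f p < f v))))
    fun v _ _ => hd v
  rw [sum_union hdis] at this
  linarith

/-- A lower bound on the Dirichlet energy of a function supported in a set all of whose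
subsets expand. -/
lemma dirichlet_energy_ge_of_expansion (a : V → V → ℝ) (ha : ∀ u v, 0 ≤ a u v)
    (hsymm : ∀ u v, a u v = a v u) (ε : ℝ) (hε0 : 0 ≤ ε) (T : Finset V)
    (h : ∀ S ⊆ T, ε * ∑ u ∈ S, ∑ v, a u v ≤
      ∑ u, ∑ v, a u v * |(if u ∈ S then (1 : ℝ) else 0) - (if v ∈ S then (1 : ℝ) else 0)|)
    (x : V → ℝ) (hxT : ∀ v, x v ≠ 0 → v ∈ T) :
    2 * (1 - √(1 - ε ^ 2 / 4)) * ∑ u, (∑ v, a u v) * x u ^ 2 ≤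
      ∑ u, ∑ v, a u v * (x u - x v) ^ 2 := by
  have hco := mul_sum_le_sum_abs_sub_of_indicator a (fun u => ∑ v, a u v) ε T h
    (fun v => x v ^ 2) (fun v => sq_nonneg _) (fun v hv => hxT v fun h' => hv (by simp [h']))
  have hcs := sum_sq_le_sum_mul_sum_of_sq_le_mul (univ : Finset (V × V))
    (r := fun p => a p.1 p.2 * |x p.1 ^ 2 - x p.2 ^ 2|)
    (f := fun p => a p.1 p.2 * (x p.1 - x p.2) ^ 2)
    (g := fun p => a p.1 p.2 * (x p.1 + x p.2) ^ 2)
    (fun p _ => mul_nonneg (ha _ _) (sq_nonneg _)) (fun p _ => mul_nonneg (ha _ _) (sq_nonneg _))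
    (fun p _ => le_of_eq (by rw [mul_pow, sq_abs]; ring))
  simp only [Fintype.sum_prod_type] at hcs
  have hm := sum_mul_add_sq a hsymm x (-1)
  have hp := sum_mul_add_sq a hsymm x 1
  simp only [neg_mul, one_mul, ← sub_eq_add_neg] at hm hp
  have hN : 0 ≤ ∑ u, (∑ v, a u v) * x u ^ 2 :=
    sum_nonneg fun u _ => mul_nonneg (sum_nonneg fun v _ => ha u v) (sq_nonneg _)
  rw [hm, hp] at hcs
  rw [hm]
  set N := ∑ u, (∑ v, a u v) * x u ^ 2
  set M := ∑ u, ∑ v, a u v * (x u * x v)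
  have hsq := (pow_le_pow_left₀ (mul_nonneg hε0 hN) hco 2).trans hcs
  have hM : M ≤ √(1 - ε ^ 2 / 4) * N := by
    rw [← Real.sqrt_sq hN, ← Real.sqrt_mul' _ (sq_nonneg N)]
    exact Real.le_sqrt_of_sq_le (by nlinarith)
  linarith

/-- The converse Cheeger inequality for a symmetric nonnegative matrix. -/
lemma sum_mul_mul_le_sqrt_mul_of_expansion (a : V → V → ℝ) (ha : ∀ u v, 0 ≤ a u v)
    (hsymm : ∀ u v, a u v = a v u) (ε : ℝ) (hε0 : 0 ≤ ε)
    (h : ∀ S : Finset V, S.Nonempty → S ≠ univ →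
      ε * min (∑ u ∈ S, ∑ v, a u v) (∑ u ∈ Sᶜ, ∑ v, a u v) ≤ 2 * ∑ u ∈ S, ∑ v ∈ Sᶜ, a u v)
    (f : V → ℝ) (hf : ∑ u, (∑ v, a u v) * f u = 0) :
    ∑ u, ∑ v, a u v * (f u * f v) ≤ √(1 - ε ^ 2 / 4) * ∑ u, (∑ v, a u v) * f u ^ 2 := by
  cases isEmpty_or_nonempty V
  · simp
  set d : V → ℝ := fun u => ∑ v, a u v with hd_def
  have hd : ∀ v, 0 ≤ d v := fun u => sum_nonneg fun v _ => ha u v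
  obtain ⟨c, hc1, hc2⟩ := exists_weighted_median d hd f
  have hexp : ∀ T : Finset V, 2 * ∑ v ∈ T, d v ≤ ∑ v, d v → ∀ S ⊆ T, ε * ∑ u ∈ S, d u ≤
      ∑ u, ∑ v, a u v *
        |(if u ∈ S then (1 : ℝ) else 0) - (if v ∈ S then (1 : ℝ) else 0)| := by
    intro T hT S hST
    have hcut : ∑ u, ∑ v, a u v *
        |(if u ∈ S then (1 : ℝ) else 0) - (if v ∈ S then (1 : ℝ) else 0)| =
        2 * ∑ u ∈ S, ∑ v ∈ Sᶜ, a u v := by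
      rw [two_mul, ← sum_add_sum_compl S]
      congr 1
      · refine sum_congr rfl fun u hu => ?_
        rw [← sum_add_sum_compl S, sum_eq_zero fun v hv => by simp [hu, hv], zero_add]
        exact sum_congr rfl fun v hv => by simp [hu, mem_compl.1 hv]
      · rw [sum_comm (s := S)]
        refine sum_congr rfl fun u hu => ?_
        rw [← sum_add_sum_compl S]
        nth_rewrite 2 [sum_eq_zero fun v hv => by simp [mem_compl.1 hu, mem_compl.1 hv]]
        rw [add_zero]
        exact sum_congr rfl fun v hv => by simp [mem_compl.1 hu, hv, hsymm u v]
    rw [hcut]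
    rcases S.eq_empty_or_nonempty with rfl | hne
    · simp
    have hle := sum_le_sum_of_subset_of_nonneg hST fun v _ _ => hd v
    have hadd := sum_add_sum_compl S d
    by_cases huniv : S = univ
    · subst huniv
      have h0 : ∑ v, d v = 0 := le_antisymm (by linarith) (sum_nonneg fun v _ => hd v)
      simp [h0]
    · have := h S hne huniv
      rwa [min_eq_left (by linarith)] at this
  set s := √(1 - ε ^ 2 / 4) with hs_def
  have hs : s ≤ 1 := Real.sqrt_le_one.2 (by nlinarith [sq_nonneg ε])
  have hpos := dirichlet_energy_ge_of_expansion a ha hsymm ε hε0 _ (hexp _ hc1)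
    (fun v => max (f v - c) 0) (fun v hv => by
      by_contra hn
      exact hv (max_eq_right (by simpa using hn)))
  have hneg := dirichlet_energy_ge_of_expansion a ha hsymm ε hε0 _ (hexp _ hc2)
    (fun v => max (c - f v) 0) (fun v hv => by
      by_contra hn
      exact hv (max_eq_right (by simpa using hn)))
  have henergy : ∑ u, ∑ v, a u v * (max (f u - c) 0 - max (f v - c) 0) ^ 2 +
      ∑ u, ∑ v, a u v * (max (c - f u) 0 - max (c - f v) 0) ^ 2 ≤
      ∑ u, ∑ v, a u v * (f u - f v) ^ 2 := by
    simp only [← sum_add_distrib, ← mul_add]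
    refine sum_le_sum fun u _ => sum_le_sum fun v _ => mul_le_mul_of_nonneg_left ?_ (ha u v)
    have hparts : ∀ z, f z - c = max (f z - c) 0 - max (c - f z) 0 ∧
        max (f z - c) 0 * max (c - f z) 0 = 0 := fun z => by
      rcases le_total (f z) c with hz | hz
      · rw [max_eq_right (by linarith), max_eq_left (by linarith)]; constructor <;> ring
      · rw [max_eq_left (by linarith), max_eq_right (by linarith)]; constructor <;> ring
    have hcross : ∀ y z, 0 ≤ max (f y - c) 0 * max (c - f z) 0 := fun y z =>
      mul_nonneg (le_max_right _ _) (le_max_right _ _)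
    have hsub : f u - f v = (max (f u - c) 0 - max (f v - c) 0) -
        (max (c - f u) 0 - max (c - f v) 0) := by linarith [(hparts u).1, (hparts v).1]
    rw [hsub]
    linarith [(hparts u).2, (hparts v).2, hcross u v, hcross v u]
  have hnorm : ∑ u, d u * f u ^ 2 ≤
      ∑ u, d u * max (f u - c) 0 ^ 2 + ∑ u, d u * max (c - f u) 0 ^ 2 := by
    have hsplit : ∑ u, d u * max (f u - c) 0 ^ 2 + ∑ u, d u * max (c - f u) 0 ^ 2 =
        ∑ u, d u * f u ^ 2 - 2 * c * ∑ u, d u * f u + ∑ u, d u * c ^ 2 := by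
      rw [mul_sum, ← sum_add_distrib, ← sum_sub_distrib, ← sum_add_distrib]
      refine sum_congr rfl fun u _ => ?_
      rcases le_total (f u) c with hu | hu
      · rw [max_eq_right (by linarith), max_eq_left (by linarith)]; ring
      · rw [max_eq_left (by linarith), max_eq_right (by linarith)]; ring
    have : 0 ≤ ∑ u, d u * c ^ 2 := sum_nonneg fun u _ => mul_nonneg (hd u) (sq_nonneg c)
    rw [hsplit, hf]
    linarith
  have hexpand := sum_mul_add_sq a hsymm f (-1)
  simp only [neg_mul, one_mul, ← sub_eq_add_neg] at hexpand
  have := mul_le_mul_of_nonneg_left hnorm (sub_nonneg.2 hs)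
  simp only [hd_def] at *
  linarith

lemma sum_pair_mem_eq_sum_incident (E : Finset (Finset V)) (hE : ∀ e ∈ E, e.card = 2)
    (w : Finset V → ℝ) (u : V) :
    ∑ v with ({u, v} : Finset V) ∈ E, w {u, v} = ∑ e ∈ E with u ∈ e, w e := by
  refine sum_bij (fun v _ => {u, v}) (fun v hv => ?_) (fun v hv v' hv' h => ?_)
    (fun e he => ?_) fun _ _ => rfl
  · simpa using hv
  · have hne : v ≠ u := by
      rintro rfl
      simpa using hE _ (mem_filter.1 hv).2
    have : v ∈ ({u, v'} : Finset V) := h ▸ by simp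
    simpa [hne] using this
  · obtain ⟨heE, hue⟩ := mem_filter.1 he
    obtain ⟨x, y, -, rfl⟩ := card_eq_two.1 (hE e heE)
    rcases (by simpa using hue : u = x ∨ u = y) with rfl | rfl
    · exact ⟨y, by simpa using heE, rfl⟩
    · exact ⟨x, by simpa [pair_comm] using heE, pair_comm _ _⟩

lemma sum_pair_mem_eq_sum_boundary (E : Finset (Finset V)) (hE : ∀ e ∈ E, e.card = 2)
    (w : Finset V → ℝ) (S : Finset V) :
    ∑ p ∈ S ×ˢ Sᶜ with ({p.1, p.2} : Finset V) ∈ E, w {p.1, p.2} =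
      ∑ e ∈ E with (e ∩ S).card = 1, w e := by
  refine sum_bij (fun p _ => {p.1, p.2}) ?_ ?_ ?_ fun _ _ => rfl
  · rintro ⟨u, v⟩ h
    simp only [mem_filter, mem_product, mem_compl] at h ⊢
    refine ⟨h.2, ?_⟩
    rw [insert_inter_of_mem h.1.1, singleton_inter_of_notMem h.1.2]
    simp
  · rintro ⟨u, v⟩ h ⟨u', v'⟩ h' heq
    simp only [mem_filter, mem_product, mem_compl] at h h' heq
    have h1 : u ∈ ({u', v'} : Finset V) := heq ▸ by simp
    have h2 : v ∈ ({u', v'} : Finset V) := heq ▸ by simp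
    simp only [mem_insert, mem_singleton] at h1 h2
    grind
  · intro e he
    obtain ⟨heE, hcard⟩ := mem_filter.1 he
    obtain ⟨x, y, hxy, rfl⟩ := card_eq_two.1 (hE e heE)
    by_cases hx : x ∈ S <;> by_cases hy : y ∈ S
    · rw [insert_inter_of_mem hx, singleton_inter_of_mem hy, card_pair hxy] at hcard
      omega
    · exact ⟨(x, y), by simp [hx, hy, heE], rfl⟩
    · exact ⟨(y, x), by simp [hx, hy, pair_comm y x, heE], pair_comm _ _⟩
    · rw [insert_inter_of_notMem hx, singleton_inter_of_notMem hy] at hcard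
      simp at hcard

end Cheeger

/-- **Converse Cheeger inequality, Friedland–Nabben.** If every nonempty
proper subset `S` satisfies the edge-expansion bound
`∑_{e : |e∩S|=1} w(e) ≥ ε·min(w(S), w(V∖S))` with `0 ≤ ε ≤ 2`, then `(G,w)` is a
`√(1-ε²/4)`-spectral expander. -/
theorem converse_cheeger_inequality {V : Type*} [Fintype V] [DecidableEq V]
    (E : Finset (Finset V))
    (hE_card : ∀ e ∈ E, e.card = 2)
    (hno_iso : ∀ v : V, ∃ e ∈ E, v ∈ e)
    (w : Finset V → ℝ)
    (hw_pos : ∀ e ∈ E, 0 < w e)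
    (hw_le : ∀ e ∈ E, w e ≤ 1)
    (hw_sum : ∑ e ∈ E, w e = 1)
    (wV : V → ℝ)
    (hwV : ∀ v : V, wV v = (1 / 2) * ∑ e ∈ E.filter (fun e => v ∈ e), w e)
    (A : (V → ℝ) → V → ℝ)
    (hA : ∀ (f : V → ℝ) (v : V), A f v =
      ∑ u ∈ Finset.univ.filter (fun u => ({v, u} : Finset V) ∈ E),
        (w {v, u} / (2 * wV v)) * f u)
    (ε : ℝ) (hε0 : 0 ≤ ε) (hε2 : ε ≤ 2)
    (hcheeger : ∀ S : Finset V, S.Nonempty → S ≠ Finset.univ →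
      ∑ e ∈ E.filter (fun e => (e ∩ S).card = 1), w e ≥
        ε * min (∑ v ∈ S, wV v) (∑ v ∈ Sᶜ, wV v))
    (f : V → ℝ) (hf : ∑ v, wV v * f v = 0) :
    ∑ v, wV v * A f v * f v ≤ Real.sqrt (1 - ε ^ 2 / 4) * ∑ v, wV v * f v * f v := by
  set a : V → V → ℝ := fun u v => if ({u, v} : Finset V) ∈ E then w {u, v} / 2 else 0 with ha_def
  have ha : ∀ u v, 0 ≤ a u v := fun u v => by
    simp only [ha_def]
    split_ifs with he
    · exact (half_pos (hw_pos _ he)).le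
    · exact le_rfl
  have hsymm : ∀ u v, a u v = a v u := fun u v => by simp only [ha_def, pair_comm u v]
  have hdeg : ∀ u, ∑ v, a u v = wV u := fun u => by
    rw [hwV, ← sum_pair_mem_eq_sum_incident E hE_card, mul_sum, sum_filter]
    exact sum_congr rfl fun v _ => by simp only [ha_def]; split_ifs <;> ring
  have hpos : ∀ v, 0 < wV v := fun v => by
    obtain ⟨e, he, hve⟩ := hno_iso v
    rw [hwV]
    exact mul_pos (by norm_num)
      (sum_pos (fun e he => hw_pos e (mem_filter.1 he).1) ⟨e, mem_filter.2 ⟨he, hve⟩⟩)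
  have hcut : ∀ S : Finset V, 2 * ∑ u ∈ S, ∑ v ∈ Sᶜ, a u v =
      ∑ e ∈ E.filter (fun e => (e ∩ S).card = 1), w e := fun S => by
    rw [← sum_pair_mem_eq_sum_boundary E hE_card, sum_filter, sum_product, mul_sum]
    refine sum_congr rfl fun u _ => ?_
    rw [mul_sum]
    exact sum_congr rfl fun v _ => by simp only [ha_def]; split_ifs <;> ring
  have key := sum_mul_mul_le_sqrt_mul_of_expansion a ha hsymm ε hε0
    (fun S hne huniv => by simpa only [hdeg, hcut] using hcheeger S hne huniv) f
    (by simpa only [hdeg] using hf)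
  simp only [hdeg] at key
  calc ∑ v, wV v * A f v * f v = ∑ u, ∑ v, a u v * (f u * f v) := by
        refine sum_congr rfl fun u _ => ?_
        rw [hA, mul_sum, sum_mul, sum_filter]
        refine sum_congr rfl fun v _ => ?_
        have := (hpos u).ne'
        simp only [ha_def]
        split_ifs
        · field_simp
        · ring
    _ ≤ _ := key
    _ = _ := by simp only [pow_two, mul_assoc]
end

section
/- Decomposition of the inner product over links. Let (X,w) be a pure d-dimensional weighted simplicial complex, let 0 ≤ k ≤ d−1, let f,g : X(k) → ℝ, and let 0 ≤ l ≤ d−k−1. Then ∑_{σ∈X(k)} w(σ) f(σ) g(σ) = ∑_{τ∈X(l)} ∑_{σ∈X(k), σ∩τ=∅, σ∪τ∈X} ( w(σ∪τ) / C(k+l+2, l+1) ) · f(σ) g(σ), where C(n,m) denotes the binomial coefficient. (Equivalently, ⟨f,g⟩ equals the expectation over τ ∈ X(l) of the link inner products ⟨f^τ, g^τ⟩_τ, where f^τ is the restriction of f to the k-faces of the link of τ.) -/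
open Finset

/-- Between `σ ⊆ ρ` there are `#ρ - #σ` sets with one more element than `σ`. -/
theorem card_filter_succ_between {V : Type*} [DecidableEq V] (X : Finset (Finset V))
    (hdown : ∀ σ ∈ X, ∀ τ ⊆ σ, τ ∈ X) {σ ρ : Finset V} (hρ : ρ ∈ X) (h : σ ⊆ ρ) :
    #{τ ∈ X | (#τ = #σ + 1 ∧ σ ⊆ τ) ∧ τ ⊆ ρ} = #ρ - #σ := by
  rw [← card_sdiff_of_subset h]
  symm
  refine card_nbij (fun x => insert x σ) ?_ ?_ ?_
  · intro x hx
    simp only [mem_coe, mem_sdiff] at hx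
    have hs : insert x σ ⊆ ρ := insert_subset hx.1 h
    simp only [mem_coe, mem_filter]
    exact ⟨hdown ρ hρ _ hs, ⟨card_insert_of_notMem hx.2, subset_insert _ _⟩, hs⟩
  · intro x hx y hy hxy
    simp only [mem_coe, mem_sdiff] at hx hy
    exact (insert_inj hx.2).1 hxy
  · intro τ hτ
    simp only [mem_coe, mem_filter] at hτ
    obtain ⟨-, ⟨hc, hσ⟩, hs⟩ := hτ
    have h1 : #(τ \ σ) = 1 := by rw [card_sdiff_of_subset hσ]; omega
    obtain ⟨x, hx⟩ := card_eq_one.1 h1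
    have hxm : x ∈ τ \ σ := hx ▸ mem_singleton_self x
    rw [mem_sdiff] at hxm
    refine ⟨x, by simp [hs hxm.1, hxm.2], ?_⟩
    change insert x σ = τ
    rw [insert_eq, ← hx, sdiff_union_of_subset hσ]

/-- In a weighted complex, the weight of a face is the normalized total weight of the faces
with `j` more elements that contain it. -/
theorem weight_mul_choose_eq_sum {V : Type*} [DecidableEq V] (d : ℕ)
    (X : Finset (Finset V)) (hdown : ∀ σ ∈ X, ∀ τ ⊆ σ, τ ∈ X) (w : Finset V → ℝ)
    (hw_rec : ∀ τ ∈ X, #τ ≤ d →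
      w τ = (1 / (#τ + 1 : ℝ)) * ∑ σ ∈ X with #σ = #τ + 1 ∧ τ ⊆ σ, w σ)
    (j : ℕ) (σ : Finset V) (hσ : σ ∈ X) (hj : #σ + j ≤ d + 1) :
    w σ * ((#σ + j).choose j : ℝ) = ∑ ρ ∈ X with #ρ = #σ + j ∧ σ ⊆ ρ, w ρ := by
  induction j generalizing σ with
  | zero =>
    have : {ρ ∈ X | #ρ = #σ + 0 ∧ σ ⊆ ρ} = {σ} := by
      ext ρ
      simp only [mem_filter, mem_singleton, add_zero]
      constructor
      · rintro ⟨-, hc, hs⟩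
        exact (eq_of_subset_of_card_le hs hc.le).symm
      · rintro rfl
        exact ⟨hσ, rfl, subset_rfl⟩
    rw [this]
    simp
  | succ j ih =>
    have hpos : (#σ + 1 : ℝ) ≠ 0 := by positivity
    have hrec : w σ * (#σ + 1 : ℝ) = ∑ τ ∈ X with #τ = #σ + 1 ∧ σ ⊆ τ, w τ := by
      rw [hw_rec σ hσ (by omega)]
      field_simp
    have hdouble : (∑ τ ∈ X with #τ = #σ + 1 ∧ σ ⊆ τ, w τ) * ((#σ + (j + 1)).choose j : ℝ) =
        (j + 1 : ℝ) * ∑ ρ ∈ X with #ρ = #σ + (j + 1) ∧ σ ⊆ ρ, w ρ := by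
      calc
        _ = ∑ τ ∈ X with #τ = #σ + 1 ∧ σ ⊆ τ,
              ∑ ρ ∈ X with #ρ = #σ + (j + 1) ∧ τ ⊆ ρ, w ρ := by
          rw [sum_mul]
          refine sum_congr rfl fun τ hτ => ?_
          obtain ⟨hX, hc, -⟩ := mem_filter.1 hτ
          have e : #σ + (j + 1) = #τ + j := by omega
          rw [e]
          exact ih τ hX (by omega)
        _ = ∑ ρ ∈ X with #ρ = #σ + (j + 1) ∧ σ ⊆ ρ,
              ∑ τ ∈ X with (#τ = #σ + 1 ∧ σ ⊆ τ) ∧ τ ⊆ ρ, w ρ := by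
          refine sum_comm' fun τ ρ => ?_
          simp only [mem_filter]
          constructor
          · rintro ⟨⟨h1, h2, h3⟩, h4, h5, h6⟩
            exact ⟨⟨h1, ⟨h2, h3⟩, h6⟩, h4, h5, h3.trans h6⟩
          · rintro ⟨⟨h1, ⟨h2, h3⟩, h6⟩, h4, h5, -⟩
            exact ⟨⟨h1, h2, h3⟩, h4, h5, h6⟩
        _ = _ := by
          rw [mul_sum]
          refine sum_congr rfl fun ρ hρ => ?_
          obtain ⟨hX, hc, hs⟩ := mem_filter.1 hρ
          rw [sum_const, card_filter_succ_between X hdown hX hs, hc, Nat.add_sub_cancel_left,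
            nsmul_eq_mul]
          push_cast
          rfl
    have hchoose : ((#σ + (j + 1)).choose (j + 1) : ℝ) * (j + 1) =
        ((#σ + (j + 1)).choose j : ℝ) * (#σ + 1) := by
      have := Nat.choose_succ_right_eq (#σ + (j + 1)) j
      rw [show #σ + (j + 1) - j = #σ + 1 by omega] at this
      exact_mod_cast this
    have hj0 : (j + 1 : ℝ) ≠ 0 := by positivity
    apply mul_left_cancel₀ hj0
    rw [← hdouble, ← hrec]
    linear_combination w σ * hchoose

/-- Faces joinable to `σ` correspond to faces containing `σ`, via union with `σ`. -/
theorem sum_union_link_eq_sum_superset {V M : Type*} [DecidableEq V] [AddCommMonoid M]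
    (X : Finset (Finset V)) (hdown : ∀ σ ∈ X, ∀ τ ⊆ σ, τ ∈ X) (w : Finset V → M)
    (σ : Finset V) (n : ℕ) :
    ∑ τ ∈ X with #τ = n ∧ σ ∩ τ = ∅ ∧ σ ∪ τ ∈ X, w (σ ∪ τ) =
      ∑ ρ ∈ X with #ρ = #σ + n ∧ σ ⊆ ρ, w ρ := by
  refine sum_nbij' (fun τ => σ ∪ τ) (fun ρ => ρ \ σ) ?_ ?_ ?_ ?_ fun _ _ => rfl
  · intro τ hτ
    obtain ⟨-, hc, hd, hu⟩ := mem_filter.1 hτ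
    refine mem_filter.2 ⟨hu, ?_, subset_union_left⟩
    rw [card_union_of_disjoint (disjoint_iff_inter_eq_empty.2 hd), hc]
  · intro ρ hρ
    obtain ⟨hX, hc, hs⟩ := mem_filter.1 hρ
    refine mem_filter.2 ⟨hdown ρ hX _ sdiff_subset, ?_, inter_sdiff_self _ _, ?_⟩
    · rw [card_sdiff_of_subset hs, hc, Nat.add_sub_cancel_left]
    · rwa [union_sdiff_of_subset hs]
  · intro τ hτ
    obtain ⟨-, -, hd, -⟩ := mem_filter.1 hτ
    exact union_sdiff_cancel_left (disjoint_iff_inter_eq_empty.2 hd)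
  · intro ρ hρ
    exact union_sdiff_of_subset (mem_filter.1 hρ).2.2



/-- **Decomposition of the inner product over links.** For a pure
`d`-dimensional weighted simplicial complex `(X,w)`, functions `f,g` on `X(k)`
(`0 ≤ k ≤ d-1`), and `0 ≤ l ≤ d-k-1`, the weighted inner product of `f` and `g` on `X(k)`
decomposes as an average over the links of faces `τ ∈ X(l)`. -/
theorem inner_product_link_decomposition {V : Type*} [Fintype V] [DecidableEq V] (d : ℕ)
    (X : Finset (Finset V))
    (hdown : ∀ σ ∈ X, ∀ τ ⊆ σ, τ ∈ X)
    (hpure : ∀ σ ∈ X, (∀ ρ ∈ X, σ ⊆ ρ → σ = ρ) → σ.card = d + 1)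
    (w : Finset V → ℝ)
    (hw_pos : ∀ σ ∈ X, 0 < w σ)
    (hw_top : ∑ σ ∈ X.filter (fun σ => σ.card = d + 1), w σ = 1)
    (hw_rec : ∀ τ ∈ X, τ.card ≤ d →
      w τ = (1 / (τ.card + 1 : ℝ)) *
        ∑ σ ∈ X.filter (fun σ => σ.card = τ.card + 1 ∧ τ ⊆ σ), w σ)
    (k l : ℕ) (hk : k + 1 ≤ d) (hl : l + k + 1 ≤ d)
    (f g : Finset V → ℝ) :
    ∑ σ ∈ X.filter (fun σ => σ.card = k + 1), w σ * f σ * g σ =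
      ∑ τ ∈ X.filter (fun τ => τ.card = l + 1),
        ∑ σ ∈ X.filter (fun σ => σ.card = k + 1 ∧ σ ∩ τ = ∅ ∧ σ ∪ τ ∈ X),
          (w (σ ∪ τ) / (Nat.choose (k + l + 2) (l + 1) : ℝ)) * f σ * g σ := by
  have hswap : ∑ τ ∈ X.filter (fun τ => τ.card = l + 1),
        ∑ σ ∈ X.filter (fun σ => σ.card = k + 1 ∧ σ ∩ τ = ∅ ∧ σ ∪ τ ∈ X),
          (w (σ ∪ τ) / (Nat.choose (k + l + 2) (l + 1) : ℝ)) * f σ * g σ =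
      ∑ σ ∈ X with #σ = k + 1, ∑ τ ∈ X with #τ = l + 1 ∧ σ ∩ τ = ∅ ∧ σ ∪ τ ∈ X,
          (w (σ ∪ τ) / (Nat.choose (k + l + 2) (l + 1) : ℝ)) * f σ * g σ := by
    refine sum_comm' fun τ σ => ?_
    simp only [mem_filter]
    tauto
  rw [hswap]
  refine sum_congr rfl fun σ hσ => ?_
  obtain ⟨hX, hc⟩ := mem_filter.1 hσ
  have hweight := weight_mul_choose_eq_sum d X hdown w hw_rec (l + 1) σ hX (by omega)
  rw [← sum_union_link_eq_sum_superset X hdown, hc,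
    show k + 1 + (l + 1) = k + l + 2 by omega] at hweight
  have hne : (Nat.choose (k + l + 2) (l + 1) : ℝ) ≠ 0 :=
    Nat.cast_ne_zero.2 (Nat.choose_pos (by omega)).ne'
  rw [← sum_mul, ← sum_mul, ← sum_div, ← hweight, mul_div_cancel_right₀ _ hne]
end

section
/- Decomposition of the Laplacian form over vertex links. Let (X,w) be a pure d-dimensional weighted simplicial complex with d ≥ 2, and let f,g : X(0) → ℝ (viewing faces in X(0) as vertices). Then ∑_{u∈X(0)} w({u}) f(u) g(u) − ∑_{(u,v) ordered, {u,v}∈X} (w({u,v})/2) · f(u) g(v) = ∑_{u∈X(0)} w({u}) · [ ∑_{v : {u,v}∈X} ( w({u,v}) / (2 w({u})) ) f(v) g(v) − ∑_{(v,x) ordered, {u,v,x}∈X} ( w({u,v,x}) / (6 w({u})) ) f(v) g(x) ]. In words: the global Laplacian quadratic form ⟨L f, g⟩_w equals the weighted average over vertices u of the Laplacian quadratic forms of the links, ⟨L_u f^u, g^u⟩_u. -/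
open Finset

/-- Summing `w` over the faces of `X` covering `τ` amounts to summing over the vertices which
extend `τ` to a face. -/
theorem sum_filter_covers_eq_sum_insert {V M : Type*} [Fintype V] [DecidableEq V]
    [AddCommMonoid M] (X : Finset (Finset V)) (w : Finset V → M) (τ : Finset V) :
    ∑ σ ∈ X.filter (fun σ => σ.card = τ.card + 1 ∧ τ ⊆ σ), w σ =
      ∑ u : V, if u ∉ τ ∧ insert u τ ∈ X then w (insert u τ) else 0 := by
  rw [← Finset.sum_filter]
  symm
  refine Finset.sum_nbij (fun u => insert u τ) ?_ ?_ ?_ (fun _ _ => rfl)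
  · intro u hu
    simp only [mem_filter, mem_univ, true_and] at hu ⊢
    exact ⟨hu.2, card_insert_of_notMem hu.1, subset_insert u τ⟩
  · intro u hu v _ huv
    simp only [coe_filter, mem_univ, true_and, Set.mem_ofPred_eq] at hu
    exact (insert_inj hu.1).1 huv
  · intro σ hσ
    simp only [coe_filter, Set.mem_ofPred_eq] at hσ
    obtain ⟨u, hu, rfl⟩ := exists_eq_insert_iff.2 ⟨hσ.2.2, hσ.2.1.symm⟩
    exact ⟨u, by simpa using ⟨hu, hσ.1⟩, rfl⟩

/-- **Decomposition of the Laplacian form over vertex links.** For a pure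
`d`-dimensional weighted simplicial complex `(X,w)` with `d ≥ 2` and functions
`f,g : X(0) → ℝ`, the global Laplacian quadratic form `⟨Lf,g⟩_w` equals the weighted
average over vertices `u` of the link Laplacian quadratic forms `⟨L_u f^u, g^u⟩_u`. -/
theorem laplacian_link_decomposition {V : Type*} [Fintype V] [DecidableEq V] (d : ℕ)
    (hd : 2 ≤ d)
    (X : Finset (Finset V))
    (hdown : ∀ σ ∈ X, ∀ τ ⊆ σ, τ ∈ X)
    (hpure : ∀ σ ∈ X, (∀ ρ ∈ X, σ ⊆ ρ → σ = ρ) → σ.card = d + 1)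
    (w : Finset V → ℝ)
    (hw_pos : ∀ σ ∈ X, 0 < w σ)
    (hw_top : ∑ σ ∈ X.filter (fun σ => σ.card = d + 1), w σ = 1)
    (hw_rec : ∀ τ ∈ X, τ.card ≤ d →
      w τ = (1 / (τ.card + 1 : ℝ)) *
        ∑ σ ∈ X.filter (fun σ => σ.card = τ.card + 1 ∧ τ ⊆ σ), w σ)
    (f g : V → ℝ) :
    (∑ u ∈ Finset.univ.filter (fun u => ({u} : Finset V) ∈ X), w {u} * f u * g u)
      - (∑ u : V, ∑ v : V,
          if u ≠ v ∧ ({u, v} : Finset V) ∈ X then (w {u, v} / 2) * f u * g v else 0) =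
    ∑ u ∈ Finset.univ.filter (fun u => ({u} : Finset V) ∈ X),
      w {u} *
        ((∑ v : V,
            if v ≠ u ∧ ({u, v} : Finset V) ∈ X then
              (w {u, v} / (2 * w {u})) * f v * g v else 0)
          - (∑ v : V, ∑ x : V,
              if v ≠ x ∧ v ≠ u ∧ x ≠ u ∧ ({u, v, x} : Finset V) ∈ X then
                (w {u, v, x} / (6 * w {u})) * f v * g x else 0)) := by
  have hrec : ∀ τ ∈ X, τ.card ≤ d →
      ∑ u : V, (if u ∉ τ ∧ insert u τ ∈ X then w (insert u τ) else 0) =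
        (τ.card + 1 : ℝ) * w τ := by
    intro τ hτ hcard
    rw [hw_rec τ hτ hcard, ← sum_filter_covers_eq_sum_insert]
    field_simp
  have hdiag : ∀ v : V,
      ∑ u : V, (if v ≠ u ∧ ({u, v} : Finset V) ∈ X then (w {u, v} / 2) * f v * g v else 0) =
        if ({v} : Finset V) ∈ X then w {v} * f v * g v else 0 := by
    intro v
    split_ifs with hv
    · have h := hrec {v} hv (by rw [card_singleton]; omega)
      rw [card_singleton] at h
      have hw : w {v} = (1 / 2) *
          ∑ u : V, if u ∉ ({v} : Finset V) ∧ insert u {v} ∈ X then w (insert u {v}) else 0 := by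
        rw [h]; push_cast; ring
      rw [hw, mul_sum, sum_mul, sum_mul]
      refine sum_congr rfl fun u _ => ?_
      simp only [mem_singleton, ne_comm (a := v), ne_eq]
      split_ifs <;> ring
    · refine sum_eq_zero fun u _ => if_neg fun h => hv (hdown _ h.2 _ (by simp))
  have hoff : ∀ v x : V,
      ∑ u : V, (if v ≠ x ∧ v ≠ u ∧ x ≠ u ∧ ({u, v, x} : Finset V) ∈ X then
          (w {u, v, x} / 6) * f v * g x else 0) =
        if v ≠ x ∧ ({v, x} : Finset V) ∈ X then (w {v, x} / 2) * f v * g x else 0 := by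
    intro v x
    split_ifs with hvx
    · have hcard := card_pair hvx.1
      have h := hrec {v, x} hvx.2 (by omega)
      rw [hcard] at h
      have hw : w {v, x} = (1 / 3) * ∑ u : V,
          if u ∉ ({v, x} : Finset V) ∧ insert u {v, x} ∈ X then w (insert u {v, x}) else 0 := by
        rw [h]; push_cast; ring
      rw [hw, mul_sum, sum_div, sum_mul, sum_mul]
      refine sum_congr rfl fun u _ => ?_
      have hiff : (v ≠ x ∧ v ≠ u ∧ x ≠ u ∧ ({u, v, x} : Finset V) ∈ X) ↔
          (u ∉ ({v, x} : Finset V) ∧ insert u {v, x} ∈ X) := by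
        simp only [mem_insert, mem_singleton, not_or, ne_eq, eq_comm (a := u)]
        tauto
      simp only [hiff]
      split_ifs <;> ring
    · refine sum_eq_zero fun u _ => if_neg fun h =>
        hvx ⟨h.1, hdown _ h.2.2.2 _ (subset_insert u {v, x})⟩
  have hlink : ∀ u : V, (if ({u} : Finset V) ∈ X then
      w {u} *
        ((∑ v : V,
            if v ≠ u ∧ ({u, v} : Finset V) ∈ X then
              (w {u, v} / (2 * w {u})) * f v * g v else 0)
          - (∑ v : V, ∑ x : V,
              if v ≠ x ∧ v ≠ u ∧ x ≠ u ∧ ({u, v, x} : Finset V) ∈ X then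
                (w {u, v, x} / (6 * w {u})) * f v * g x else 0)) else 0) =
      (∑ v : V, if v ≠ u ∧ ({u, v} : Finset V) ∈ X then (w {u, v} / 2) * f v * g v else 0)
        - ∑ v : V, ∑ x : V, if v ≠ x ∧ v ≠ u ∧ x ≠ u ∧ ({u, v, x} : Finset V) ∈ X then
            (w {u, v, x} / 6) * f v * g x else 0 := by
    intro u
    split_ifs with hu
    · have hne := (hw_pos _ hu).ne'
      simp only [mul_sub, mul_sum, mul_ite, mul_zero]
      congr 1
      · refine sum_congr rfl fun v _ => if_congr Iff.rfl ?_ rfl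
        field_simp
      · refine sum_congr rfl fun v _ => sum_congr rfl fun x _ => if_congr Iff.rfl ?_ rfl
        field_simp
    · rw [sum_eq_zero fun v _ => if_neg fun h => hu (hdown _ h.2 _ (by simp)),
        sum_eq_zero fun v _ => sum_eq_zero fun x _ =>
          if_neg fun h => hu (hdown _ h.2.2.2 _ (by simp)), sub_zero]
  rw [sum_filter, sum_filter, sum_congr rfl fun u _ => hlink u, sum_sub_distrib]
  congr 1
  · rw [sum_comm]
    exact sum_congr rfl fun v _ => (hdiag v).symm
  · conv_rhs => rw [sum_comm]
    refine sum_congr rfl fun v _ => ?_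
    conv_rhs => rw [sum_comm]
    exact sum_congr rfl fun x _ => (hoff v x).symm
end

section
/- Trickling Down Theorem (Oppenheim). Let (X,w) be a pure d-dimensional weighted simplicial complex with d ≥ 2 and let 0 < λ < 1. Assume: (i) for every face τ ∈ X with 1 ≤ |τ| ≤ d−1, the link graph of τ is connected and λ₂(A_τ) ≤ λ; and (ii) the link graph of the empty face (the 1-skeleton of X) is connected. Then for every face τ ∈ X with 0 ≤ |τ| ≤ d−1, including the empty face, λ₂(A_τ) ≤ λ/(1−λ); i.e., X is a λ/(1−λ)-local spectral expander. -/
open Finset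

/-- The vertices of the link of a face `τ`. -/
def linkVerts {V : Type*} [Fintype V] [DecidableEq V]
    (X : Finset (Finset V)) (τ : Finset V) : Finset V :=
  Finset.univ.filter fun v => v ∉ τ ∧ insert v τ ∈ X

/-- Adjacency in the link graph of a face `τ`. -/
def linkAdj {V : Type*} [Fintype V] [DecidableEq V]
    (X : Finset (Finset V)) (τ : Finset V) (v x : V) : Prop :=
  v ∈ linkVerts X τ ∧ x ∈ linkVerts X τ ∧ v ≠ x ∧ insert v (insert x τ) ∈ X

/-- The link graph of `τ` is connected. -/
def linkConnected {V : Type*} [Fintype V] [DecidableEq V]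
    (X : Finset (Finset V)) (τ : Finset V) : Prop :=
  ∀ v ∈ linkVerts X τ, ∀ x ∈ linkVerts X τ, Relation.ReflTransGen (linkAdj X τ) v x

/-- `λ₂(A_τ) ≤ γ`: every function on the link vertices of `τ` orthogonal to constants
(w.r.t. the link weights) has Rayleigh quotient at most `γ` for the link random-walk
matrix `A_τ(v,x) = w(τ∪{v,x}) / ((|τ|+2)·w(τ∪{v}))`. -/
def lamTwoLe {V : Type*} [Fintype V] [DecidableEq V]
    (X : Finset (Finset V)) (w : Finset V → ℝ) (τ : Finset V) (γ : ℝ) : Prop :=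
  ∀ g : V → ℝ,
    (∑ v ∈ linkVerts X τ, w (insert v τ) * g v) = 0 →
    (∑ v ∈ linkVerts X τ, ∑ x ∈ linkVerts X τ,
        if v ≠ x ∧ insert x (insert v τ) ∈ X then
          w (insert v τ) *
            (w (insert x (insert v τ)) / ((τ.card + 2 : ℝ) * w (insert v τ))) * g v * g x
        else 0)
      ≤ γ * ∑ v ∈ linkVerts X τ, w (insert v τ) * g v ^ 2

/-- The weight of `insert x τ` if `x` is a vertex of the link of `τ`, and zero otherwise. -/
noncomputable def linkWeight {V : Type*} [DecidableEq V]
    (X : Finset (Finset V)) (w : Finset V → ℝ) (τ : Finset V) (x : V) : ℝ :=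
  if x ∉ τ ∧ insert x τ ∈ X then w (insert x τ) else 0

/-- The weight of `insert y (insert x τ)` if `x, y` span an edge of the link of `τ`, and zero
otherwise. -/
noncomputable def linkEdgeWeight {V : Type*} [DecidableEq V]
    (X : Finset (Finset V)) (w : Finset V → ℝ) (τ : Finset V) (x y : V) : ℝ :=
  if x ∉ τ then linkWeight X w (insert x τ) y else 0

section Spectral

variable {V : Type*} [Fintype V]

/-- A symmetric operator whose eigenvectors with eigenvalue above `c` are all orthogonal to `g`
has Rayleigh quotient at most `c` at `g`. -/
lemma LinearMap.IsSymmetric.inner_apply_self_le {E : Type*} [NormedAddCommGroup E]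
    [InnerProductSpace ℝ E] [FiniteDimensional ℝ E] {T : E →ₗ[ℝ] E} (hT : T.IsSymmetric)
    (c : ℝ) (g : E) (h : ∀ (μ : ℝ) (f : E), T f = μ • f → μ ≤ c ∨ inner ℝ f g = 0) :
    inner ℝ (T g) g ≤ c * inner ℝ g g := by
  set b := hT.eigenvectorBasis rfl
  have hb : ∀ i, T (b i) = hT.eigenvalues rfl i • b i := hT.apply_eigenvectorBasis rfl
  rw [← b.sum_inner_mul_inner (T g) g, ← b.sum_inner_mul_inner g g, Finset.mul_sum]
  refine Finset.sum_le_sum fun i _ => ?_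
  rw [hT, hb, inner_smul_right, real_inner_comm (b i) g]
  rcases h _ _ (hb i) with hi | hi
  · rw [mul_assoc]
    exact mul_le_mul_of_nonneg_right hi (mul_self_nonneg _)
  · simp [hi]

/-- The weighted form of `LinearMap.IsSymmetric.inner_apply_self_le`, for the generalized
eigenvalue problem `W f = μ m f` with a nonnegative diagonal weight `m`. -/
lemma sum_mul_mul_le_of_generalized_eigenvectors [DecidableEq V] (W : V → V → ℝ) (m : V → ℝ)
    (hsymm : ∀ v x, W v x = W x v) (hm : ∀ v, 0 ≤ m v) (hzero : ∀ v x, m v = 0 → W v x = 0)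
    (c : ℝ) (g : V → ℝ)
    (h : ∀ (μ : ℝ) (f : V → ℝ), (∀ v, ∑ x, W v x * f x = μ * m v * f v) →
      μ ≤ c ∨ ∑ v, m v * f v * g v = 0) :
    ∑ v, ∑ x, W v x * g v * g x ≤ c * ∑ v, m v * g v ^ 2 := by
  set S : Matrix V V ℝ := Matrix.of fun v x => W v x / (√(m v) * √(m x))
  have hW : ∀ v x, W v x = √(m v) * √(m x) * S v x := by
    intro v x
    by_cases hv : m v = 0
    · simp [hzero v x hv, hv]
    by_cases hx : m x = 0
    · simp [hsymm v x, hzero x v hx, hx]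
    have := Real.sqrt_ne_zero'.2 ((hm v).lt_of_ne' hv)
    have := Real.sqrt_ne_zero'.2 ((hm x).lt_of_ne' hx)
    simp only [S, Matrix.of_apply]
    field_simp
  have hS : S.IsHermitian := by
    ext v x
    simp [S, hsymm x v, mul_comm]
  have key := (Matrix.isSymmetric_toEuclideanLin_iff.2 hS).inner_apply_self_le c
    (WithLp.toLp 2 fun v => √(m v) * g v) ?_
  · simp only [PiLp.inner_apply, Matrix.toLpLin_apply, Matrix.mulVec, dotProduct,
      RCLike.inner_apply, conj_trivial] at key
    convert key using 1
    · refine Finset.sum_congr rfl fun v _ => ?_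
      rw [Finset.mul_sum]
      refine Finset.sum_congr rfl fun x _ => ?_
      rw [hW]
      ring
    · congr 1
      refine Finset.sum_congr rfl fun v _ => ?_
      nth_rewrite 1 [← Real.mul_self_sqrt (hm v)]
      ring
  · intro μ u hu
    have hu' : ∀ v, ∑ x, S v x * u x = μ * u v := fun v => by
      simpa [Matrix.toLpLin_apply, Matrix.mulVec, dotProduct] using
        congrArg (fun z : EuclideanSpace ℝ V => z v) hu
    refine (h μ (fun v => u v / √(m v)) fun v => ?_).imp_right fun h0 => ?_
    · have h1 : ∀ x, W v x * (u x / √(m x)) = √(m v) * (S v x * u x) := by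
        intro x
        by_cases hx : m x = 0
        · simp [hx, S]
        have := Real.sqrt_ne_zero'.2 ((hm x).lt_of_ne' hx)
        rw [hW]
        field_simp
      simp only [h1, ← Finset.mul_sum, hu']
      by_cases hv : m v = 0
      · simp [hv]
      have := Real.sqrt_ne_zero'.2 ((hm v).lt_of_ne' hv)
      nth_rewrite 2 [← Real.mul_self_sqrt (hm v)]
      field_simp
    · rw [← h0]
      simp only [PiLp.inner_apply, RCLike.inner_apply, conj_trivial]
      refine Finset.sum_congr rfl fun v _ => ?_
      by_cases hv : m v = 0
      · simp [hv]
      have := Real.sqrt_ne_zero'.2 ((hm v).lt_of_ne' hv)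
      nth_rewrite 2 [← Real.mul_self_sqrt (hm v)]
      field_simp

variable (e : V → V → ℝ) (m : V → ℝ)

/-- The Dirichlet form of an eigenfunction. -/
lemma sum_mul_sub_sq_of_eigenvector (hsymm : ∀ v x, e v x = e x v)
    (hdeg : ∀ v, ∑ x, e v x = 2 * m v) (γ : ℝ) (f : V → ℝ)
    (hf : ∀ v, ∑ x, e v x * f x = 2 * γ * m v * f v) :
    ∑ v, ∑ x, e v x * (f v - f x) ^ 2 = 4 * (1 - γ) * ∑ v, m v * f v ^ 2 := by
  have h1 : ∑ v, ∑ x, e v x * f v ^ 2 = 2 * ∑ v, m v * f v ^ 2 := by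
    simp_rw [← Finset.sum_mul, hdeg, Finset.mul_sum, mul_assoc]
  have h2 : ∑ v, ∑ x, e v x * f x ^ 2 = 2 * ∑ v, m v * f v ^ 2 := by
    rw [← h1, Finset.sum_comm]
    simp_rw [fun v x => hsymm x v]
  have h3 : ∑ v, ∑ x, e v x * f x * f v = 2 * γ * ∑ v, m v * f v ^ 2 := by
    simp_rw [← Finset.sum_mul, hf, Finset.mul_sum]
    exact Finset.sum_congr rfl fun v _ => by ring
  have h4 : ∑ v, ∑ x, e v x * (f v - f x) ^ 2 = ∑ v, ∑ x, e v x * f v ^ 2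
      + ∑ v, ∑ x, e v x * f x ^ 2 - 2 * ∑ v, ∑ x, e v x * f x * f v := by
    simp only [Finset.mul_sum, ← Finset.sum_add_distrib, ← Finset.sum_sub_distrib]
    exact Finset.sum_congr rfl fun v _ => Finset.sum_congr rfl fun x _ => by ring
  rw [h4, h1, h2, h3]
  ring

/-- Garland's localization: summing the local spectral bounds over all vertex links constrains
every eigenvalue of the `1`-skeleton. -/
lemma eigenvalue_localization (t : V → V → V → ℝ) (lam : ℝ)
    (hsymm : ∀ v x, e v x = e x v) (hdeg : ∀ v, ∑ x, e v x = 2 * m v)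
    (htsymm : ∀ v x y, t v x y = t v y x) (htdeg : ∀ v x, ∑ y, t v x y = 3 * e v x)
    (htdeg' : ∀ x y, ∑ v, t v x y = 3 * e x y)
    (hloc : ∀ v, ∀ g : V → ℝ, ∑ x, e v x * g x = 0 →
      ∑ x, ∑ y, t v x y * g x * g y ≤ 3 * lam * ∑ x, e v x * g x ^ 2)
    (γ : ℝ) (f : V → ℝ) (hf : ∀ v, ∑ x, e v x * f x = 2 * γ * m v * f v) :
    (1 - γ) * γ * ∑ v, m v * f v ^ 2 ≤ (1 - γ) * (lam * (1 + γ)) * ∑ v, m v * f v ^ 2 := by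
  have hv : ∀ v, ∑ x, ∑ y, t v x y * f x * f y - 6 * γ ^ 2 * (m v * f v ^ 2)
      ≤ 3 * lam * (∑ x, e v x * f x ^ 2 - 2 * γ ^ 2 * (m v * f v ^ 2)) := by
    intro v
    set a := γ * f v
    have h1 : ∑ x, e v x * (f x - a) = 0 := by
      simp_rw [mul_sub, Finset.sum_sub_distrib, ← Finset.sum_mul, hf, hdeg]
      ring
    have h2 : ∑ x, e v x * (f x - a) ^ 2
        = ∑ x, e v x * f x ^ 2 - 2 * γ ^ 2 * (m v * f v ^ 2) := by
      have : ∑ x, e v x * (f x - a) ^ 2 = ∑ x, e v x * f x ^ 2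
          - 2 * a * ∑ x, e v x * f x + a ^ 2 * ∑ x, e v x := by
        simp only [Finset.mul_sum, ← Finset.sum_add_distrib, ← Finset.sum_sub_distrib]
        exact Finset.sum_congr rfl fun x _ => by ring
      rw [this, hf, hdeg]
      ring
    have h3 : ∑ x, ∑ y, t v x y * (f x - a) * (f y - a)
        = ∑ x, ∑ y, t v x y * f x * f y - 6 * γ ^ 2 * (m v * f v ^ 2) := by
      have : ∑ x, ∑ y, t v x y * (f x - a) * (f y - a) = ∑ x, ∑ y, t v x y * f x * f y
          - a * ∑ x, (∑ y, t v x y) * f x - a * ∑ y, (∑ x, t v x y) * f y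
          + a ^ 2 * ∑ x, ∑ y, t v x y := by
        simp only [Finset.sum_mul]
        rw [Finset.sum_comm (f := fun y x => t v x y * f y)]
        simp only [Finset.mul_sum, ← Finset.sum_add_distrib, ← Finset.sum_sub_distrib]
        exact Finset.sum_congr rfl fun x _ => Finset.sum_congr rfl fun y _ => by ring
      have hcol : ∀ y, ∑ x, t v x y = 3 * e v y := fun y => by
        rw [← htdeg]
        exact Finset.sum_congr rfl fun x _ => htsymm v x y
      rw [this]
      simp_rw [hcol, htdeg, mul_assoc, ← Finset.mul_sum, hf, hdeg]
      ring
    rw [← h2, ← h3]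
    exact hloc v _ h1
  have hsum := Finset.sum_le_sum fun v (_ : v ∈ Finset.univ) => hv v
  simp only [Finset.sum_sub_distrib, ← Finset.mul_sum] at hsum
  have h1 : ∑ v, ∑ x, ∑ y, t v x y * f x * f y = 6 * γ * ∑ v, m v * f v ^ 2 := by
    rw [Finset.sum_comm]
    simp_rw [Finset.sum_comm (s := Finset.univ) (t := Finset.univ)
      (f := fun v y => t v _ y * f _ * f y), ← Finset.sum_mul, htdeg']
    rw [Finset.mul_sum]
    refine Finset.sum_congr rfl fun x _ => ?_
    have : ∑ y, 3 * e x y * f x * f y = 3 * f x * ∑ y, e x y * f y := by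
      rw [Finset.mul_sum]
      exact Finset.sum_congr rfl fun y _ => by ring
    rw [this, hf]
    ring
  have h2 : ∑ v, ∑ x, e v x * f x ^ 2 = 2 * ∑ v, m v * f v ^ 2 := by
    rw [Finset.sum_comm, Finset.mul_sum]
    refine Finset.sum_congr rfl fun x _ => ?_
    simp_rw [← Finset.sum_mul, fun v => hsymm v x, hdeg, mul_assoc]
  rw [h1, h2] at hsum
  linarith

end Spectral

section LinkWeight

variable {V : Type*} [DecidableEq V] {X : Finset (Finset V)} {w : Finset V → ℝ}

lemma linkWeight_nonneg (hw : ∀ σ ∈ X, 0 < w σ) (τ : Finset V) (x : V) :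
    0 ≤ linkWeight X w τ x := by
  unfold linkWeight
  split_ifs with h
  · exact (hw _ h.2).le
  · rfl

lemma linkEdgeWeight_comm (τ : Finset V) (x y : V) :
    linkEdgeWeight X w τ x y = linkEdgeWeight X w τ y x := by
  simp only [linkEdgeWeight, linkWeight, Finset.mem_insert, Finset.insert_comm y x τ, eq_comm]
  split_ifs <;> grind

lemma linkEdgeWeight_singleton_comm (v x y : V) :
    linkEdgeWeight X w {v} x y = linkEdgeWeight X w {x} v y := by
  simp only [linkEdgeWeight, Finset.mem_singleton, Finset.pair_comm x v, eq_comm]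

variable [Fintype V]

lemma linkWeight_of_mem {τ : Finset V} {x : V} (hx : x ∈ linkVerts X τ) :
    linkWeight X w τ x = w (insert x τ) := by
  simp only [linkVerts, Finset.mem_filter, Finset.mem_univ, true_and] at hx
  simp [linkWeight, hx]

lemma linkWeight_of_notMem {τ : Finset V} {x : V} (hx : x ∉ linkVerts X τ) :
    linkWeight X w τ x = 0 := by
  simp only [linkVerts, Finset.mem_filter, Finset.mem_univ, true_and] at hx
  simp [linkWeight, hx]

lemma sum_linkVerts_mul (τ : Finset V) (g : V → ℝ) :
    ∑ x ∈ linkVerts X τ, w (insert x τ) * g x = ∑ x, linkWeight X w τ x * g x := by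
  rw [← Finset.sum_subset (Finset.subset_univ (linkVerts X τ))
    fun x _ hx => by rw [linkWeight_of_notMem hx, zero_mul]]
  exact Finset.sum_congr rfl fun x hx => by rw [linkWeight_of_mem hx]

lemma linkEdgeWeight_eq_zero_of_notMem (hdown : ∀ σ ∈ X, ∀ τ ⊆ σ, τ ∈ X) {τ : Finset V} {x : V}
    (hx : x ∉ linkVerts X τ) (y : V) : linkEdgeWeight X w τ x y = 0 := by
  simp only [linkVerts, Finset.mem_filter, Finset.mem_univ, true_and] at hx
  simp only [linkEdgeWeight, linkWeight]
  split_ifs with h1 h2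
  · rfl
  · exact absurd ⟨h1, hdown _ h2.2 _ (Finset.subset_insert _ _)⟩ hx
  · rfl

/-- The bound `lamTwoLe` in terms of sums over the whole vertex set. -/
lemma lamTwoLe_iff (hdown : ∀ σ ∈ X, ∀ τ ⊆ σ, τ ∈ X) (hw : ∀ σ ∈ X, 0 < w σ)
    (τ : Finset V) (γ : ℝ) :
    lamTwoLe X w τ γ ↔ ∀ g : V → ℝ, ∑ x, linkWeight X w τ x * g x = 0 →
      ∑ x, ∑ y, linkEdgeWeight X w τ x y * g x * g y
        ≤ (τ.card + 2) * γ * ∑ x, linkWeight X w τ x * g x ^ 2 := by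
  unfold lamTwoLe
  refine forall_congr' fun g => ?_
  rw [sum_linkVerts_mul, sum_linkVerts_mul τ fun x => g x ^ 2]
  have hc : (0 : ℝ) < τ.card + 2 := by positivity
  have hsum : (∑ v ∈ linkVerts X τ, ∑ x ∈ linkVerts X τ,
        if v ≠ x ∧ insert x (insert v τ) ∈ X then
          w (insert v τ) *
            (w (insert x (insert v τ)) / ((τ.card + 2 : ℝ) * w (insert v τ))) * g v * g x
        else 0) = (∑ x, ∑ y, linkEdgeWeight X w τ x y * g x * g y) / (τ.card + 2) := by
    rw [Finset.sum_div, ← Finset.sum_subset (Finset.subset_univ (linkVerts X τ))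
      fun x _ hx => by simp [linkEdgeWeight_eq_zero_of_notMem hdown hx]]
    refine Finset.sum_congr rfl fun x hx => ?_
    rw [Finset.sum_div, ← Finset.sum_subset (Finset.subset_univ (linkVerts X τ))
      fun y _ hy => by
        simp [linkEdgeWeight_comm τ x y, linkEdgeWeight_eq_zero_of_notMem hdown hy]]
    refine Finset.sum_congr rfl fun y hy => ?_
    simp only [linkVerts, Finset.mem_filter, Finset.mem_univ, true_and] at hx hy
    have hne := (hw _ hx.2).ne'
    have hiff : (x ≠ y ∧ insert y (insert x τ) ∈ X) ↔
        (y ∉ insert x τ ∧ insert y (insert x τ) ∈ X) := by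
      simp [hy.1, eq_comm]
    simp only [linkEdgeWeight, linkWeight, hx.1, not_false_eq_true, if_true, hiff]
    split_ifs
    · field_simp
    · simp
  rw [hsum, div_le_iff₀ hc, mul_right_comm, mul_comm γ]

/-- The balancing condition on the weights. -/
lemma sum_linkWeight {d : ℕ}
    (hw_rec : ∀ τ ∈ X, τ.card ≤ d →
      w τ = (1 / (τ.card + 1 : ℝ)) *
        ∑ σ ∈ X.filter (fun σ => σ.card = τ.card + 1 ∧ τ ⊆ σ), w σ)
    {τ : Finset V} (hτ : τ ∈ X) (hd : τ.card ≤ d) :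
    ∑ y, linkWeight X w τ y = (τ.card + 1) * w τ := by
  have hc : (τ.card + 1 : ℝ) ≠ 0 := by positivity
  rw [hw_rec τ hτ hd, ← mul_assoc, mul_one_div_cancel hc, one_mul]
  simp only [linkWeight, ← Finset.sum_filter]
  refine Finset.sum_bij (fun y _ => insert y τ) ?_ ?_ ?_ fun _ _ => rfl
  · intro y hy
    simp only [Finset.mem_filter, Finset.mem_univ, true_and] at hy
    simp [hy]
  · intro y hy z hz h
    simp only [Finset.mem_filter, Finset.mem_univ, true_and] at hy hz
    exact (Finset.insert_inj hy.1).1 h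
  · intro σ hσ
    simp only [Finset.mem_filter] at hσ
    obtain ⟨y, hy, rfl⟩ := Finset.exists_eq_insert_iff.2 ⟨hσ.2.2, hσ.2.1.symm⟩
    exact ⟨y, by simp [hy, hσ.1], rfl⟩

lemma sum_linkEdgeWeight (hdown : ∀ σ ∈ X, ∀ τ ⊆ σ, τ ∈ X) {d : ℕ}
    (hw_rec : ∀ τ ∈ X, τ.card ≤ d →
      w τ = (1 / (τ.card + 1 : ℝ)) *
        ∑ σ ∈ X.filter (fun σ => σ.card = τ.card + 1 ∧ τ ⊆ σ), w σ)
    {τ : Finset V} (hd : τ.card + 1 ≤ d) (x : V) :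
    ∑ y, linkEdgeWeight X w τ x y = (τ.card + 2) * linkWeight X w τ x := by
  by_cases hx : x ∈ linkVerts X τ
  · rw [linkWeight_of_mem hx]
    simp only [linkVerts, Finset.mem_filter, Finset.mem_univ, true_and] at hx
    have hcard := Finset.card_insert_of_notMem hx.1
    simp only [linkEdgeWeight, hx.1, not_false_eq_true, if_true]
    rw [sum_linkWeight hw_rec hx.2 (by omega), hcard]
    push_cast
    ring
  · simp [linkEdgeWeight_eq_zero_of_notMem hdown hx, linkWeight_of_notMem hx]

lemma linkEdgeWeight_pos (hw : ∀ σ ∈ X, 0 < w σ) {τ : Finset V} {v x : V}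
    (h : linkAdj X τ v x) : 0 < linkEdgeWeight X w τ v x := by
  obtain ⟨hv, hx, hne, hX⟩ := h
  simp only [linkVerts, Finset.mem_filter, Finset.mem_univ, true_and] at hv hx
  rw [Finset.insert_comm] at hX
  simpa [linkEdgeWeight, linkWeight, hv, hx, hne.symm, hX] using hw _ hX

lemma lamTwoLe.mono (hw : ∀ σ ∈ X, 0 < w σ) {τ : Finset V} {γ γ' : ℝ} (hγ : γ ≤ γ')
    (h : lamTwoLe X w τ γ) : lamTwoLe X w τ γ' := by
  intro g hg
  refine (h g hg).trans (mul_le_mul_of_nonneg_right hγ (Finset.sum_nonneg fun v hv => ?_))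
  simp only [linkVerts, Finset.mem_filter, Finset.mem_univ, true_and] at hv
  exact mul_nonneg (hw _ hv.2).le (sq_nonneg _)

end LinkWeight

/-- **Trickling Down Theorem, Oppenheim.** Let `(X,w)` be a pure
`d`-dimensional weighted simplicial complex, `d ≥ 2`, `0 < λ < 1`.  If every link of a
face `τ` with `1 ≤ |τ| ≤ d-1` is connected with `λ₂(A_τ) ≤ λ`, and the `1`-skeleton
(the link of the empty face) is connected, then for every face `τ` with `|τ| ≤ d-1`
(including the empty face) we have `λ₂(A_τ) ≤ λ/(1-λ)`. -/
theorem trickling_down {V : Type*} [Fintype V] [DecidableEq V] (d : ℕ) (hd : 2 ≤ d)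
    (X : Finset (Finset V))
    (hdown : ∀ σ ∈ X, ∀ τ ⊆ σ, τ ∈ X)
    (hpure : ∀ σ ∈ X, (∀ ρ ∈ X, σ ⊆ ρ → σ = ρ) → σ.card = d + 1)
    (w : Finset V → ℝ)
    (hw_pos : ∀ σ ∈ X, 0 < w σ)
    (hw_top : ∑ σ ∈ X.filter (fun σ => σ.card = d + 1), w σ = 1)
    (hw_rec : ∀ τ ∈ X, τ.card ≤ d →
      w τ = (1 / (τ.card + 1 : ℝ)) *
        ∑ σ ∈ X.filter (fun σ => σ.card = τ.card + 1 ∧ τ ⊆ σ), w σ)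
    (lam : ℝ) (hlam0 : 0 < lam) (hlam1 : lam < 1)
    (hlinks : ∀ τ ∈ X, 1 ≤ τ.card → τ.card + 1 ≤ d →
      linkConnected X τ ∧ lamTwoLe X w τ lam)
    (hskel : linkConnected X (∅ : Finset V)) :
    ∀ τ ∈ X, τ.card + 1 ≤ d → lamTwoLe X w τ (lam / (1 - lam)) := by
  have hle : lam ≤ lam / (1 - lam) := le_div_self hlam0.le (by linarith) (by linarith)
  intro τ hτ hτd
  rcases Finset.eq_empty_or_nonempty τ with rfl | hne
  swap
  · exact (hlinks τ hτ hne.card_pos hτd).2.mono hw_pos hle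
  set m := linkWeight X w ∅
  set e := linkEdgeWeight X w ∅
  have hm : ∀ v, 0 ≤ m v := linkWeight_nonneg hw_pos ∅
  have he : ∀ v x, e v x = linkWeight X w {v} x := fun v x => by simp [e, linkEdgeWeight]
  have hsymm : ∀ v x, e v x = e x v := linkEdgeWeight_comm ∅
  have hdeg : ∀ v, ∑ x, e v x = 2 * m v := fun v => by
    simpa using sum_linkEdgeWeight hdown hw_rec hτd v
  have htdeg : ∀ v x, ∑ y, linkEdgeWeight X w {v} x y = 3 * e v x := fun v x => by
    rw [sum_linkEdgeWeight hdown hw_rec (by simpa using hd), he]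
    norm_num
  have hloc : ∀ v, ∀ g : V → ℝ, ∑ x, e v x * g x = 0 →
      ∑ x, ∑ y, linkEdgeWeight X w {v} x y * g x * g y
        ≤ 3 * lam * ∑ x, e v x * g x ^ 2 := by
    intro v g hg
    by_cases hv : ({v} : Finset V) ∈ X
    · have := (lamTwoLe_iff hdown hw_pos {v} lam).1 (hlinks {v} hv (by simp) (by simpa using hd)).2
        g (by simpa only [he] using hg)
      simp only [he]
      convert this using 3
      norm_num
    · have h0 : ∀ x, linkWeight X w {v} x = 0 := fun x =>
        linkWeight_of_notMem fun hx => hv <| hdown _ (Finset.mem_filter.1 hx).2.2 _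
          (Finset.subset_insert _ _)
      have h1 : ∀ x y, linkEdgeWeight X w {v} x y = 0 := fun x y =>
        linkEdgeWeight_eq_zero_of_notMem hdown (fun hx => hv <|
          hdown _ (Finset.mem_filter.1 hx).2.2 _ (Finset.subset_insert _ _)) y
      simp [he, h0, h1]
  rw [lamTwoLe_iff hdown hw_pos]
  intro g hg
  have key := sum_mul_mul_le_of_generalized_eigenvectors e m hsymm hm
    (fun v x hv => (Finset.sum_eq_zero_iff_of_nonneg fun x _ => by
      rw [he]; exact linkWeight_nonneg hw_pos _ _).1 (by rw [hdeg, hv, mul_zero]) x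
        (Finset.mem_univ x))
    (2 * (lam / (1 - lam))) g ?_
  · simpa using key
  intro μ f hf
  obtain ⟨γ, rfl⟩ : ∃ γ, μ = 2 * γ := ⟨μ / 2, by ring⟩
  have hN : 0 ≤ ∑ v, m v * f v ^ 2 :=
    Finset.sum_nonneg fun v _ => mul_nonneg (hm v) (sq_nonneg _)
  rcases lt_or_ge γ 1 with hγ | hγ
  · rcases hN.eq_or_lt with hN | hN
    · right
      refine Finset.sum_eq_zero fun v _ => ?_
      have := (Finset.sum_eq_zero_iff_of_nonneg fun v _ =>
        mul_nonneg (hm v) (sq_nonneg (f v))).1 hN.symm v (Finset.mem_univ v)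
      rcases mul_eq_zero.1 this with h | h
      · simp [h]
      · simp [pow_eq_zero_iff two_ne_zero |>.1 h]
    · left
      have h := eigenvalue_localization e m (fun v x y => linkEdgeWeight X w {v} x y) lam
        hsymm hdeg (fun v => linkEdgeWeight_comm {v}) htdeg
        (fun x y => by
          rw [← htdeg]
          exact Finset.sum_congr rfl fun v _ => by
            rw [linkEdgeWeight_singleton_comm, linkEdgeWeight_comm])
        hloc γ f hf
      have h' := le_of_mul_le_mul_left (le_of_mul_le_mul_right h hN) (sub_pos.2 hγ)
      have : γ ≤ lam / (1 - lam) := by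
        rw [le_div_iff₀ (by linarith)]
        linarith
      linarith
  · right
    have hnn : ∀ v x, 0 ≤ e v x * (f v - f x) ^ 2 := fun v x =>
      mul_nonneg (by rw [he]; exact linkWeight_nonneg hw_pos _ _) (sq_nonneg _)
    have hD : ∑ v, ∑ x, e v x * (f v - f x) ^ 2 = 0 := by
      refine le_antisymm ?_ (Finset.sum_nonneg fun v _ => Finset.sum_nonneg fun x _ => hnn v x)
      rw [sum_mul_sub_sq_of_eigenvector e m hsymm hdeg γ f hf]
      exact mul_nonpos_of_nonpos_of_nonneg (by linarith) hN
    have hadj : ∀ v x, linkAdj X ∅ v x → f v = f x := by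
      intro v x h
      have h1 := (Finset.sum_eq_zero_iff_of_nonneg fun v _ =>
        Finset.sum_nonneg fun x _ => hnn v x).1 hD v (Finset.mem_univ v)
      have h2 := (Finset.sum_eq_zero_iff_of_nonneg fun x _ => hnn v x).1 h1 x (Finset.mem_univ x)
      have h3 := (mul_eq_zero.1 h2).resolve_left (linkEdgeWeight_pos hw_pos h).ne'
      exact sub_eq_zero.1 (pow_eq_zero_iff two_ne_zero |>.1 h3)
    have hconst : ∀ v ∈ linkVerts X ∅, ∀ x ∈ linkVerts X ∅, f v = f x := by
      intro v hv x hx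
      have := hskel v hv x hx
      clear hx
      induction this with
      | refl => rfl
      | tail _ h ih => exact ih.trans (hadj _ _ h)
    rcases (linkVerts X ∅).eq_empty_or_nonempty with h | ⟨z, hz⟩
    · refine Finset.sum_eq_zero fun v _ => ?_
      have : m v = 0 := linkWeight_of_notMem (by simp [h])
      simp [this]
    · have : ∀ v, m v * f v * g v = f z * (m v * g v) := by
        intro v
        by_cases hv : v ∈ linkVerts X ∅
        · rw [hconst v hv z hz]
          ring
        · have : m v = 0 := linkWeight_of_notMem hv
          simp [this]
      rw [Finset.sum_congr rfl fun v _ => this v, ← Finset.mul_sum, hg, mul_zero]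
end

section
/- Laplacian form of the trickling down theorem. Let (X,w) be a pure d-dimensional weighted simplicial complex with d ≥ 2 whose 1-skeleton is connected, and let λ > 0. Assume that for every vertex u ∈ X(0), the link Laplacian satisfies λ₂(L_u) ≥ λ: for every g : X_u(0) → ℝ with ∑_v w({u,v}) g(v) = 0, ∑_v w({u,v}) g(v)² − ∑_{v,x∈X_u(0)} w({u,v}) A_u(v,x) g(v) g(x) ≥ λ · ∑_v w({u,v}) g(v)². Then every nontrivial eigenvalue of the global Laplacian L = I − A_∅ satisfies μ ≥ 2 − 1/λ: if f : X(0) → ℝ is nonzero, ∑_u w({u}) f(u) = 0, and f(u) − (A_∅ f)(u) = μ·f(u) for all u, then μ ≥ 2 − 1/λ. -/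
open Finset

/-- Faces with one more element than `τ` containing `τ` correspond to the vertices of its link. -/
lemma sum_cofaces_eq {V : Type*} [Fintype V] [DecidableEq V] (X : Finset (Finset V))
    (w : Finset V → ℝ) (τ : Finset V) :
    ∑ σ ∈ X.filter (fun σ => σ.card = τ.card + 1 ∧ τ ⊆ σ), w σ =
      ∑ v, if v ∉ τ ∧ insert v τ ∈ X then w (insert v τ) else 0 := by
  rw [← Finset.sum_filter]
  symm
  refine Finset.sum_bij (fun v _ => insert v τ) ?_ ?_ ?_ ?_
  · intro v hv
    simp only [Finset.mem_filter, Finset.mem_univ, true_and] at hv ⊢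
    exact ⟨hv.2, Finset.card_insert_of_notMem hv.1, Finset.subset_insert v τ⟩
  · intro v hv x _ h
    simp only [Finset.mem_filter, Finset.mem_univ, true_and] at hv
    have hvx : v ∈ insert x τ := h ▸ Finset.mem_insert_self v τ
    exact (Finset.mem_insert.1 hvx).resolve_right hv.1
  · intro σ hσ
    simp only [Finset.mem_filter] at hσ
    obtain ⟨hX, hcard, hsub⟩ := hσ
    obtain ⟨v, hv, rfl⟩ := (Finset.covBy_iff_exists_insert.1
      (Finset.covBy_iff_card_sdiff_eq_one.2 ⟨hsub, by
        rw [Finset.card_sdiff_of_subset hsub]; omega⟩))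
    exact ⟨v, by simp [hv, hX], rfl⟩
  · intro v _
    rfl

/-- The Dirichlet form of a weighted graph, expanded. -/
lemma sum_mul_sub_sq {V : Type*} [Fintype V] (m : V → ℝ) (E : V → V → ℝ)
    (hE : ∀ u v, E u v = E v u) (hm : ∀ u, ∑ v, E u v = 2 * m u) (μ : ℝ) (f : V → ℝ)
    (heig : ∀ u, ∑ v, E u v * f v = 2 * m u * (1 - μ) * f u) :
    ∑ u, ∑ v, E u v * (f u - f v) ^ 2 = 4 * μ * ∑ u, m u * f u ^ 2 := by
  have h1 : ∑ u, ∑ v, E u v * f u ^ 2 = 2 * ∑ u, m u * f u ^ 2 := by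
    simp_rw [← Finset.sum_mul, hm, Finset.mul_sum, mul_assoc]
  have h2 : ∑ u, ∑ v, E u v * f v ^ 2 = 2 * ∑ u, m u * f u ^ 2 := by
    rw [Finset.sum_comm, ← h1]
    simp_rw [hE]
  have h3 : ∑ u, ∑ v, E u v * (f u * f v) = 2 * (1 - μ) * ∑ u, m u * f u ^ 2 := by
    rw [Finset.mul_sum]
    refine Finset.sum_congr rfl fun u _ => ?_
    trans f u * ∑ v, E u v * f v
    · rw [Finset.mul_sum]
      exact Finset.sum_congr rfl fun v _ => by ring
    · rw [heig]; ring
  have h4 : ∑ u, ∑ v, E u v * (f u - f v) ^ 2 =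
      ∑ u, ∑ v, E u v * f u ^ 2 + ∑ u, ∑ v, E u v * f v ^ 2
        - 2 * ∑ u, ∑ v, E u v * (f u * f v) := by
    simp_rw [Finset.mul_sum, ← Finset.sum_add_distrib, ← Finset.sum_sub_distrib]
    exact Finset.sum_congr rfl fun u _ => Finset.sum_congr rfl fun v _ => by ring
  rw [h4, h1, h2, h3]; ring

/-- Averaging the spectral gap inequalities of the links applied to an eigenfunction. -/
lemma trickling_down_inequality {V : Type*} [Fintype V] (m : V → ℝ) (E : V → V → ℝ)
    (T : V → V → V → ℝ) (hE : ∀ u v, E u v = E v u)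
    (hT : ∀ u v x, T u v x = T u x v) (hT' : ∀ u v x, T u v x = T v x u)
    (hm : ∀ u, ∑ v, E u v = 2 * m u) (hsum : ∀ u v, ∑ x, T u v x = 3 * E u v)
    (lam : ℝ)
    (hlink : ∀ u, ∀ g : V → ℝ, ∑ v, E u v * g v = 0 →
      lam * ∑ v, E u v * g v ^ 2 ≤
        ∑ v, E u v * g v ^ 2 - ∑ v, ∑ x, T u v x / 3 * g v * g x)
    (μ : ℝ) (f : V → ℝ)
    (heig : ∀ u, ∑ v, E u v * f v = 2 * m u * (1 - μ) * f u) :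
    lam * (1 - (1 - μ) ^ 2) * ∑ u, m u * f u ^ 2 ≤ μ * ∑ u, m u * f u ^ 2 := by
  have hlocal : ∀ u, lam * (∑ v, E u v * f v ^ 2 - 2 * (1 - μ) ^ 2 * (m u * f u ^ 2)) ≤
      ∑ v, E u v * f v ^ 2 - ∑ v, ∑ x, T u v x / 3 * (f v * f x) := by
    intro u
    set c := (1 - μ) * f u with hc
    have h1 : ∑ v, E u v * (f v - c) = 0 := by
      simp_rw [mul_sub, Finset.sum_sub_distrib, ← Finset.sum_mul, heig, hm, hc]
      ring
    have h2 : ∑ v, E u v * (f v - c) ^ 2 = ∑ v, E u v * f v ^ 2 - 2 * m u * c ^ 2 := by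
      have : ∑ v, E u v * (f v - c) ^ 2 =
          ∑ v, E u v * f v ^ 2 - 2 * c * ∑ v, E u v * f v + (∑ v, E u v) * c ^ 2 := by
        simp_rw [Finset.mul_sum, Finset.sum_mul, ← Finset.sum_sub_distrib,
          ← Finset.sum_add_distrib]
        exact Finset.sum_congr rfl fun v _ => by ring
      rw [this, heig, hm, hc]; ring
    have h3 : ∑ v, ∑ x, T u v x / 3 * f v = 2 * m u * c := by
      simp_rw [← Finset.sum_mul, ← Finset.sum_div, hsum, hc]
      rw [← mul_assoc, ← heig]
      exact Finset.sum_congr rfl fun v _ => by ring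
    have h4 : ∑ v, ∑ x, T u v x / 3 * f x = 2 * m u * c := by
      rw [Finset.sum_comm, ← h3]
      exact Finset.sum_congr rfl fun v _ => Finset.sum_congr rfl fun x _ => by rw [hT]
    have h5 : ∑ v, ∑ x, T u v x / 3 = 2 * m u := by
      simp_rw [← Finset.sum_div, hsum, ← hm]
      rw [← Finset.mul_sum]; ring
    have h6 : ∑ v, ∑ x, T u v x / 3 * (f v - c) * (f x - c) =
        ∑ v, ∑ x, T u v x / 3 * (f v * f x) - 2 * m u * c ^ 2 := by
      have : ∑ v, ∑ x, T u v x / 3 * (f v - c) * (f x - c) =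
          ∑ v, ∑ x, T u v x / 3 * (f v * f x) - c * ∑ v, ∑ x, T u v x / 3 * f v
            - c * ∑ v, ∑ x, T u v x / 3 * f x + c ^ 2 * ∑ v, ∑ x, T u v x / 3 := by
        simp_rw [Finset.mul_sum, ← Finset.sum_sub_distrib, ← Finset.sum_add_distrib]
        exact Finset.sum_congr rfl fun v _ => Finset.sum_congr rfl fun x _ => by ring
      rw [this, h3, h4, h5]; ring
    have := hlink u (fun v => f v - c) h1
    rw [h2, h6] at this
    have hc2 : 2 * m u * c ^ 2 = 2 * (1 - μ) ^ 2 * (m u * f u ^ 2) := by rw [hc]; ring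
    rw [hc2] at this
    linarith
  have hS : ∑ u, ∑ v, E u v * f v ^ 2 = 2 * ∑ u, m u * f u ^ 2 := by
    rw [Finset.sum_comm, Finset.mul_sum]
    refine Finset.sum_congr rfl fun u _ => ?_
    simp_rw [← Finset.sum_mul, hE _ u, hm, mul_assoc]
  have hR : ∑ u, ∑ v, ∑ x, T u v x / 3 * (f v * f x) =
      2 * (1 - μ) * ∑ u, m u * f u ^ 2 := by
    rw [Finset.sum_comm, Finset.mul_sum]
    refine Finset.sum_congr rfl fun v _ => ?_
    rw [Finset.sum_comm]
    trans f v * ∑ x, E v x * f x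
    · rw [Finset.mul_sum]
      refine Finset.sum_congr rfl fun x _ => ?_
      simp_rw [← Finset.sum_mul, ← Finset.sum_div, hT' _ v x, hsum]
      ring
    · rw [heig]; ring
  have := Finset.sum_le_sum fun u (_ : u ∈ Finset.univ) => hlocal u
  rw [← Finset.mul_sum, Finset.sum_sub_distrib, Finset.sum_sub_distrib, hS, hR,
    ← Finset.mul_sum] at this
  linarith

/-- **Laplacian form of the trickling down theorem.** Let `(X,w)` be a pure
`d`-dimensional weighted simplicial complex (`d ≥ 2`) with connected `1`-skeleton, and
`λ > 0`.  Suppose every vertex link Laplacian has `λ₂(L_u) ≥ λ`.  Then every nontrivial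
eigenvalue `μ` of the global Laplacian `L = I - A_∅` satisfies `μ ≥ 2 - 1/λ`. -/
theorem laplacian_trickling_down {V : Type*} [Fintype V] [DecidableEq V]
    (d : ℕ) (hd : 2 ≤ d)
    (X : Finset (Finset V))
    (hdown : ∀ σ ∈ X, ∀ τ ⊆ σ, τ ∈ X)
    (hpure : ∀ σ ∈ X, (∀ ρ ∈ X, σ ⊆ ρ → σ = ρ) → σ.card = d + 1)
    (w : Finset V → ℝ)
    (hw_pos : ∀ σ ∈ X, 0 < w σ)
    (hw_top : ∑ σ ∈ X.filter (fun σ => σ.card = d + 1), w σ = 1)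
    (hw_rec : ∀ τ ∈ X, τ.card ≤ d →
      w τ = (1 / (τ.card + 1 : ℝ)) *
        ∑ σ ∈ X.filter (fun σ => σ.card = τ.card + 1 ∧ τ ⊆ σ), w σ)
    -- the 1-skeleton (graph on X(0) with edges X(1)) is connected
    (hskel : ∀ u v : V, ({u} : Finset V) ∈ X → ({v} : Finset V) ∈ X →
      Relation.ReflTransGen (fun a b => a ≠ b ∧ ({a, b} : Finset V) ∈ X) u v)
    (lam : ℝ) (hlam : 0 < lam)
    -- λ₂(L_u) ≥ λ for every vertex link
    (hlink : ∀ u : V, ({u} : Finset V) ∈ X →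
      ∀ g : V → ℝ,
        (∑ v ∈ Finset.univ.filter (fun v => v ≠ u ∧ ({u, v} : Finset V) ∈ X),
          w {u, v} * g v) = 0 →
        (∑ v ∈ Finset.univ.filter (fun v => v ≠ u ∧ ({u, v} : Finset V) ∈ X),
            w {u, v} * g v ^ 2)
          - (∑ v ∈ Finset.univ.filter (fun v => v ≠ u ∧ ({u, v} : Finset V) ∈ X),
              ∑ x ∈ Finset.univ.filter (fun x => x ≠ u ∧ ({u, x} : Finset V) ∈ X),
                if v ≠ x ∧ ({u, v, x} : Finset V) ∈ X then
                  w {u, v} * (w {u, v, x} / (3 * w {u, v})) * g v * g x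
                else 0)
          ≥ lam * ∑ v ∈ Finset.univ.filter (fun v => v ≠ u ∧ ({u, v} : Finset V) ∈ X),
              w {u, v} * g v ^ 2)
    (μ : ℝ) (f : V → ℝ)
    (hf_ne : ∃ u : V, ({u} : Finset V) ∈ X ∧ f u ≠ 0)
    (hf_orth : ∑ u ∈ Finset.univ.filter (fun u => ({u} : Finset V) ∈ X), w {u} * f u = 0)
    (heig : ∀ u : V, ({u} : Finset V) ∈ X →
      f u - (∑ v ∈ Finset.univ.filter (fun v => v ≠ u ∧ ({u, v} : Finset V) ∈ X),
        (w {u, v} / (2 * w {u})) * f v) = μ * f u) :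
    μ ≥ 2 - 1 / lam := by
  set m : V → ℝ := fun u => if ({u} : Finset V) ∈ X then w {u} else 0 with hm_def
  set E : V → V → ℝ := fun u v => if v ≠ u ∧ ({u, v} : Finset V) ∈ X then w {u, v} else 0
    with hE_def
  set T : V → V → V → ℝ := fun u v x =>
    if (v ≠ u ∧ x ≠ u ∧ v ≠ x) ∧ ({u, v, x} : Finset V) ∈ X then w {u, v, x} else 0 with hT_def
  have hvert : ∀ {u v : V}, ({u, v} : Finset V) ∈ X → ({u} : Finset V) ∈ X :=
    fun h => hdown _ h _ (by simp)
  have hE0 : ∀ u, ({u} : Finset V) ∉ X → ∀ v, E u v = 0 := fun u hu v =>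
    if_neg fun h => hu (hvert h.2)
  have hTE : ∀ u v, ¬ (v ≠ u ∧ ({u, v} : Finset V) ∈ X) → ∀ x, T u v x = 0 := fun u v huv x =>
    if_neg fun h => huv ⟨h.1.1, hdown _ h.2 _ (by intro a; simp; tauto)⟩
  have hE_nonneg : ∀ u v, 0 ≤ E u v := by
    intro u v
    simp only [hE_def]
    split_ifs with h
    exacts [(hw_pos _ h.2).le, le_rfl]
  have hm_nonneg : ∀ u, 0 ≤ m u := by
    intro u
    simp only [hm_def]
    split_ifs with h
    exacts [(hw_pos _ h).le, le_rfl]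
  have hE : ∀ u v, E u v = E v u := by
    intro u v
    simp only [hE_def, Finset.pair_comm u v, ne_comm (a := u)]
  have hT : ∀ u v x, T u v x = T u x v := by
    intro u v x
    have hset : ({u, v, x} : Finset V) = {u, x, v} := by rw [Finset.pair_comm v x]
    simp only [hT_def, hset]
    exact if_congr (by tauto) rfl rfl
  have hT' : ∀ u v x, T u v x = T v x u := by
    intro u v x
    have hset : ({u, v, x} : Finset V) = {v, x, u} := by ext a; simp; tauto
    simp only [hT_def, hset]
    exact if_congr (by tauto) rfl rfl
  have hm : ∀ u, ∑ v, E u v = 2 * m u := by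
    intro u
    by_cases hu : ({u} : Finset V) ∈ X
    · have h := hw_rec _ hu (by simp; omega)
      rw [sum_cofaces_eq] at h
      have h' : ∑ v, E u v = ∑ v, if v ∉ ({u} : Finset V) ∧ insert v {u} ∈ X
          then w (insert v {u}) else 0 :=
        Finset.sum_congr rfl fun v _ => by
          simp only [hE_def, Finset.mem_singleton, Finset.pair_comm u v, ne_eq]
      rw [h']
      simp only [hm_def, if_pos hu]
      rw [h]
      simp only [Finset.card_singleton]
      push_cast
      ring
    · simp [hE0 u hu, hm_def, hu]
  have hsum : ∀ u v, ∑ x, T u v x = 3 * E u v := by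
    intro u v
    by_cases huv : v ≠ u ∧ ({u, v} : Finset V) ∈ X
    · have hcard : ({u, v} : Finset V).card = 2 := Finset.card_pair huv.1.symm
      have h := hw_rec _ huv.2 (by omega)
      rw [sum_cofaces_eq] at h
      have h' : ∑ x, T u v x = ∑ x, if x ∉ ({u, v} : Finset V) ∧ insert x {u, v} ∈ X
          then w (insert x {u, v}) else 0 := by
        refine Finset.sum_congr rfl fun x _ => ?_
        have hset : ({u, v, x} : Finset V) = {x, u, v} := by ext a; simp; tauto
        simp only [hT_def, hset, Finset.mem_insert, Finset.mem_singleton]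
        have := huv.1
        exact if_congr (by tauto) rfl rfl
      rw [h']
      simp only [hE_def, if_pos huv]
      rw [h, hcard]
      push_cast
      ring
    · rw [show E u v = 0 from if_neg huv]
      simp [hTE u v huv]
  have hsumE : ∀ u (h : V → ℝ),
      ∑ v ∈ Finset.univ.filter (fun v => v ≠ u ∧ ({u, v} : Finset V) ∈ X), w {u, v} * h v =
        ∑ v, E u v * h v := by
    intro u h
    rw [Finset.sum_filter]
    simp only [hE_def, ite_mul, zero_mul]
  have hlink' : ∀ u, ∀ g : V → ℝ, ∑ v, E u v * g v = 0 →
      lam * ∑ v, E u v * g v ^ 2 ≤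
        ∑ v, E u v * g v ^ 2 - ∑ v, ∑ x, T u v x / 3 * g v * g x := by
    intro u g hg
    by_cases hu : ({u} : Finset V) ∈ X
    · have h := hlink u hu g (by rw [hsumE, hg])
      rw [hsumE u fun v => g v ^ 2] at h
      refine h.le.trans_eq ?_
      congr 1
      rw [Finset.sum_filter]
      refine Finset.sum_congr rfl fun v _ => ?_
      split_ifs with huv
      · rw [Finset.sum_filter]
        refine Finset.sum_congr rfl fun x _ => ?_
        have hw := (hw_pos _ huv.2).ne'
        by_cases hx : (v ≠ u ∧ x ≠ u ∧ v ≠ x) ∧ ({u, v, x} : Finset V) ∈ X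
        · have hux : ({u, x} : Finset V) ∈ X := hdown _ hx.2 _ (by intro a; simp; tauto)
          rw [if_pos ⟨hx.1.2.1, hux⟩, if_pos ⟨hx.1.2.2, hx.2⟩]
          simp only [hT_def, if_pos hx]
          field_simp
        · rw [show T u v x = 0 from if_neg hx]
          have := huv.1
          split_ifs with h1 h2
          · exact absurd ⟨⟨this, h1.1, h2.1⟩, h2.2⟩ hx
          all_goals ring
      · simp [hTE u v huv]
    · have : ∀ v x, T u v x = 0 := fun v x => hTE u v (fun h => hu (hvert h.2)) x
      simp [hE0 u hu, this]
  have heig' : ∀ u, ∑ v, E u v * f v = 2 * m u * (1 - μ) * f u := by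
    intro u
    by_cases hu : ({u} : Finset V) ∈ X
    · have h := heig u hu
      have hw := (hw_pos _ hu).ne'
      have h' : ∑ v ∈ Finset.univ.filter (fun v => v ≠ u ∧ ({u, v} : Finset V) ∈ X),
          (w {u, v} / (2 * w {u})) * f v = (∑ v, E u v * f v) / (2 * w {u}) := by
        rw [← hsumE, Finset.sum_div]
        exact Finset.sum_congr rfl fun v _ => by ring
      rw [h', sub_eq_iff_eq_add, ← sub_eq_iff_eq_add', eq_div_iff (by positivity)] at h
      simp only [hm_def, if_pos hu]
      linarith
    · simp [hE0 u hu, hm_def, hu]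
  obtain ⟨u₀, hu₀, hfu₀⟩ := hf_ne
  have hS : 0 < ∑ u, m u * f u ^ 2 := by
    refine Finset.sum_pos' (fun u _ => mul_nonneg (hm_nonneg u) (sq_nonneg _))
      ⟨u₀, Finset.mem_univ _, ?_⟩
    simp only [hm_def, if_pos hu₀]
    have := hw_pos _ hu₀
    positivity
  have hμ : 0 < μ := by
    by_contra! hμ
    have hD := sum_mul_sub_sq m E hE hm μ f heig'
    have hterm : ∀ u v, 0 ≤ E u v * (f u - f v) ^ 2 := fun u v =>
      mul_nonneg (hE_nonneg u v) (sq_nonneg _)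
    have hzero : ∑ u, ∑ v, E u v * (f u - f v) ^ 2 = 0 :=
      le_antisymm (by rw [hD]; nlinarith)
        (Finset.sum_nonneg fun u _ => Finset.sum_nonneg fun v _ => hterm u v)
    have hedge : ∀ u v, u ≠ v ∧ ({u, v} : Finset V) ∈ X → f u = f v := by
      intro u v huv
      have h1 := (Finset.sum_eq_zero_iff_of_nonneg
        fun u _ => Finset.sum_nonneg fun v _ => hterm u v).1 hzero u (Finset.mem_univ u)
      have h2 := (Finset.sum_eq_zero_iff_of_nonneg fun v _ => hterm u v).1 h1 v
        (Finset.mem_univ v)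
      have hpos : E u v ≠ 0 := by
        simp only [hE_def, if_pos (show v ≠ u ∧ _ from ⟨huv.1.symm, huv.2⟩)]
        exact (hw_pos _ huv.2).ne'
      exact sub_eq_zero.1 (pow_eq_zero_iff two_ne_zero |>.1 ((mul_eq_zero.1 h2).resolve_left hpos))
    have hconst : ∀ v, ({v} : Finset V) ∈ X → f v = f u₀ := by
      intro v hv
      induction hskel u₀ v hu₀ hv with
      | refl => rfl
      | tail _ hbc ih => exact (hedge _ _ hbc).symm.trans (ih (hvert hbc.2))
    have hmass : 0 < ∑ u ∈ Finset.univ.filter (fun u => ({u} : Finset V) ∈ X), w {u} :=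
      Finset.sum_pos (fun u hu => hw_pos _ (by simpa using hu)) ⟨u₀, by simpa using hu₀⟩
    have : (∑ u ∈ Finset.univ.filter (fun u => ({u} : Finset V) ∈ X), w {u}) * f u₀ = 0 := by
      rw [← hf_orth, Finset.sum_mul]
      exact Finset.sum_congr rfl fun u hu => by rw [hconst u (by simpa using hu)]
    exact hfu₀ ((mul_eq_zero.1 this).resolve_left hmass.ne')
  have hkey := le_of_mul_le_mul_right
    (trickling_down_inequality m E T hE hT hT' hm hsum lam hlink' μ f heig') hS
  have hkey' : lam * (2 - μ) ≤ 1 := by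
    refine le_of_mul_le_mul_right ?_ hμ
    linarith
  have : 2 - μ ≤ 1 / lam := by
    rw [le_div_iff₀ hlam]
    linarith
  linarith
end

section
/- Rapid mixing of high dimensional random walks (Kaufman–Oppenheim). Let (X,w) be a pure d-dimensional weighted simplicial complex and let γ ≥ 0. Assume X is a γ-local spectral expander: for every face τ ∈ X with |τ| ≤ d−1 (including the empty face), the link graph of τ is connected and λ₂(A_τ) ≤ γ. Then for every 1 ≤ k ≤ d, the down-up walk W⁻_k on X(k) satisfies λ₂(W⁻_k) ≤ 1 − 1/(k+1) + (k/2)·γ; that is, for every f : X(k) → ℝ with ∑_{σ∈X(k)} w(σ) f(σ) = 0, ∑_{σ∈X(k)} w(σ) (W⁻_k f)(σ) f(σ) ≤ (1 − 1/(k+1) + (k/2)γ) · ∑_{σ∈X(k)} w(σ) f(σ)². -/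
open Finset

/-- The down-up walk `W⁻_k` on `X(k)`:
`(W⁻_k f)(σ) = ∑_{τ∈X(k-1), τ⊂σ} (1/(k+1)) · ∑_{σ'∈X(k), τ⊂σ'} (w σ' / ((k+1)·w τ)) · f σ'`. -/
noncomputable def downUp {V : Type*} [Fintype V] [DecidableEq V]
    (X : Finset (Finset V)) (w : Finset V → ℝ) (k : ℕ)
    (f : Finset V → ℝ) (σ : Finset V) : ℝ :=
  ∑ τ ∈ X.filter (fun τ => τ.card = k ∧ τ ⊆ σ),
    (1 / (k + 1 : ℝ)) *
      ∑ σ' ∈ X.filter (fun σ' => σ'.card = k + 1 ∧ τ ⊆ σ'),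
        (w σ' / ((k + 1 : ℝ) * w τ)) * f σ'

section Links

variable {V : Type*} [DecidableEq V] {X : Finset (Finset V)}

lemma sum_facets_eq_sum_erase (hdown : ∀ σ ∈ X, ∀ τ ⊆ σ, τ ∈ X) {σ : Finset V} (hσ : σ ∈ X)
    {k : ℕ} (hc : σ.card = k + 1) (φ : Finset V → ℝ) :
    ∑ τ ∈ X.filter (fun τ => τ.card = k ∧ τ ⊆ σ), φ τ = ∑ v ∈ σ, φ (σ.erase v) := by
  symm
  refine Finset.sum_bij (fun v _ => σ.erase v) ?_ ?_ ?_ (fun _ _ => rfl)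
  · intro v hv
    refine Finset.mem_filter.2 ⟨hdown _ hσ _ (Finset.erase_subset _ _), ?_,
      Finset.erase_subset _ _⟩
    rw [Finset.card_erase_of_mem hv, hc]; rfl
  · intro v hv x hx h
    exact Finset.erase_injOn σ hv hx h
  · intro τ hτ
    obtain ⟨_, hcτ, hs⟩ := Finset.mem_filter.1 hτ
    obtain ⟨v, hv, rfl⟩ :=
      (Finset.covBy_iff_exists_insert.1 (Finset.covBy_iff_card_sdiff_eq_one.2
        ⟨hs, by rw [Finset.card_sdiff_of_subset hs]; omega⟩))
    exact ⟨v, Finset.mem_insert_self _ _, Finset.erase_insert hv⟩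

variable [Fintype V]

lemma mem_linkVerts {τ : Finset V} {v : V} :
    v ∈ linkVerts X τ ↔ v ∉ τ ∧ insert v τ ∈ X := by
  simp [linkVerts]

/-- Summing over a face and a vertex of its link is summing over a face of the next dimension
and one of its vertices. -/
lemma sum_sum_linkVerts (hdown : ∀ σ ∈ X, ∀ τ ⊆ σ, τ ∈ X) (i : ℕ) (Φ : Finset V → V → ℝ) :
    ∑ τ ∈ X.filter (fun τ => τ.card = i), ∑ v ∈ linkVerts X τ, Φ τ v =
      ∑ ρ ∈ X.filter (fun ρ => ρ.card = i + 1), ∑ v ∈ ρ, Φ (ρ.erase v) v := by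
  rw [Finset.sum_sigma', Finset.sum_sigma']
  refine Finset.sum_bij' (fun p _ => ⟨insert p.2 p.1, p.2⟩) (fun p _ => ⟨p.1.erase p.2, p.2⟩)
    ?_ ?_ ?_ ?_ ?_
  · rintro ⟨τ, v⟩ h
    simp only [Finset.mem_sigma, Finset.mem_filter, mem_linkVerts] at h ⊢
    obtain ⟨⟨_, hc⟩, hv, hi⟩ := h
    exact ⟨⟨hi, by rw [Finset.card_insert_of_notMem hv, hc]⟩, Finset.mem_insert_self _ _⟩
  · rintro ⟨ρ, v⟩ h
    simp only [Finset.mem_sigma, Finset.mem_filter, mem_linkVerts] at h ⊢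
    obtain ⟨⟨hρ, hc⟩, hv⟩ := h
    refine ⟨⟨hdown _ hρ _ (Finset.erase_subset _ _), ?_⟩, Finset.notMem_erase _ _, ?_⟩
    · rw [Finset.card_erase_of_mem hv, hc]; rfl
    · rwa [Finset.insert_erase hv]
  · rintro ⟨τ, v⟩ h
    simp only [Finset.mem_sigma, mem_linkVerts] at h
    simp [Finset.erase_insert h.2.1]
  · rintro ⟨ρ, v⟩ h
    simp only [Finset.mem_sigma] at h
    simp [Finset.insert_erase h.2]
  · rintro ⟨τ, v⟩ h
    simp only [Finset.mem_sigma, mem_linkVerts] at h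
    simp [Finset.erase_insert h.2.1]

lemma sum_linkVerts_insert (τ : Finset V) (φ : Finset V → ℝ) :
    ∑ v ∈ linkVerts X τ, φ (insert v τ) =
      ∑ σ ∈ X.filter (fun σ => σ.card = τ.card + 1 ∧ τ ⊆ σ), φ σ := by
  refine Finset.sum_bij (fun v _ => insert v τ) ?_ ?_ ?_ (fun _ _ => rfl)
  · intro v hv
    rw [mem_linkVerts] at hv
    exact Finset.mem_filter.2
      ⟨hv.2, Finset.card_insert_of_notMem hv.1, Finset.subset_insert _ _⟩
  · intro v hv x _ h
    exact (Finset.insert_inj (mem_linkVerts.1 hv).1).1 h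
  · intro σ hσ
    obtain ⟨hσX, hc, hs⟩ := Finset.mem_filter.1 hσ
    obtain ⟨v, hv, rfl⟩ :=
      (Finset.covBy_iff_exists_insert.1 (Finset.covBy_iff_card_sdiff_eq_one.2
        ⟨hs, by rw [Finset.card_sdiff_of_subset hs]; omega⟩))
    exact ⟨v, mem_linkVerts.2 ⟨hv, hσX⟩, rfl⟩

/-- The average of `f` over the faces `τ ∪ {v}`, for `τ` a face with `k` elements. -/
noncomputable def downAvg (X : Finset (Finset V)) (w : Finset V → ℝ) (k : ℕ)
    (f : Finset V → ℝ) (τ : Finset V) : ℝ :=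
  (∑ v ∈ linkVerts X τ, w (insert v τ) * f (insert v τ)) / ((k + 1 : ℝ) * w τ)

variable {w : Finset V → ℝ}

/-- The down and up operators are adjoint to each other. -/
lemma sum_mul_downAvg_mul (hdown : ∀ σ ∈ X, ∀ τ ⊆ σ, τ ∈ X) (hw_pos : ∀ σ ∈ X, 0 < w σ)
    (k : ℕ) (f h : Finset V → ℝ) :
    ∑ τ ∈ X.filter (fun τ => τ.card = k), w τ * downAvg X w k f τ * h τ =
      ∑ σ ∈ X.filter (fun σ => σ.card = k + 1),
        w σ * f σ * ((1 / (k + 1 : ℝ)) * ∑ v ∈ σ, h (σ.erase v)) := by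
  have hk : (k + 1 : ℝ) ≠ 0 := by positivity
  trans ∑ τ ∈ X.filter (fun τ => τ.card = k), ∑ v ∈ linkVerts X τ,
      w (insert v τ) * f (insert v τ) * ((1 / (k + 1 : ℝ)) * h τ)
  · refine Finset.sum_congr rfl fun τ hτ => ?_
    have := (hw_pos τ (Finset.mem_filter.1 hτ).1).ne'
    rw [← Finset.sum_mul, downAvg]
    field_simp
  · rw [sum_sum_linkVerts hdown]
    refine Finset.sum_congr rfl fun σ _ => ?_
    rw [Finset.mul_sum, Finset.mul_sum]
    refine Finset.sum_congr rfl fun v hv => ?_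
    rw [Finset.insert_erase hv]

lemma sum_mul_downUp_mul (hdown : ∀ σ ∈ X, ∀ τ ⊆ σ, τ ∈ X) (hw_pos : ∀ σ ∈ X, 0 < w σ)
    (k : ℕ) (f : Finset V → ℝ) :
    ∑ σ ∈ X.filter (fun σ => σ.card = k + 1), w σ * downUp X w k f σ * f σ =
      ∑ τ ∈ X.filter (fun τ => τ.card = k), w τ * downAvg X w k f τ ^ 2 := by
  have h := sum_mul_downAvg_mul hdown hw_pos k f (downAvg X w k f)
  simp only [sq, ← mul_assoc] at h ⊢
  rw [h]
  refine Finset.sum_congr rfl fun σ hσ => ?_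
  obtain ⟨hσ, hc⟩ := Finset.mem_filter.1 hσ
  have key : downUp X w k f σ = 1 / (k + 1 : ℝ) * ∑ v ∈ σ, downAvg X w k f (σ.erase v) := by
    rw [← sum_facets_eq_sum_erase hdown hσ hc, Finset.mul_sum, downUp]
    refine Finset.sum_congr rfl fun τ hτ => ?_
    obtain ⟨_, hcτ, _⟩ := Finset.mem_filter.1 hτ
    rw [downAvg, sum_linkVerts_insert τ (fun σ => w σ * f σ), hcτ, Finset.sum_div]
    congr 1
    exact Finset.sum_congr rfl fun σ' _ => by ring
  rw [key]
  ring

/-- The quadratic form of the non-lazy up-down walk is a sum over the links. -/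
lemma sum_sum_link_pairs (hdown : ∀ σ ∈ X, ∀ τ ⊆ σ, τ ∈ X) (k : ℕ) (g : Finset V → ℝ) :
    ∑ τ ∈ X.filter (fun τ => τ.card = k), ∑ v ∈ linkVerts X τ, ∑ x ∈ linkVerts X τ,
        (if v ≠ x ∧ insert x (insert v τ) ∈ X then
          w (insert x (insert v τ)) * g (insert v τ) * g (insert x τ) else 0) =
      ∑ σ ∈ X.filter (fun σ => σ.card = k + 2), ∑ x ∈ σ, ∑ v ∈ σ.erase x,
        w σ * g (σ.erase x) * g (σ.erase v) := by
  rw [sum_sum_linkVerts hdown k (fun τ v => ∑ x ∈ linkVerts X τ,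
        (if v ≠ x ∧ insert x (insert v τ) ∈ X then
          w (insert x (insert v τ)) * g (insert v τ) * g (insert x τ) else 0))]
  trans ∑ ρ ∈ X.filter (fun ρ => ρ.card = k + 1), ∑ x ∈ linkVerts X ρ, ∑ v ∈ ρ,
      w (insert x ρ) * g ρ * g (insert x (ρ.erase v))
  · refine Finset.sum_congr rfl fun ρ _ => ?_
    rw [Finset.sum_comm (s := linkVerts X ρ)]
    refine Finset.sum_congr rfl fun v hv => ?_
    rw [Finset.insert_erase hv, ← Finset.sum_filter]
    refine Finset.sum_congr ?_ fun _ _ => rfl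
    ext x
    simp only [Finset.mem_filter, mem_linkVerts, Finset.mem_erase]
    constructor
    · rintro ⟨⟨h1, h2⟩, h3, h4⟩
      exact ⟨fun h => h1 ⟨h3.symm, h⟩, h4⟩
    · rintro ⟨h1, h2⟩
      exact ⟨⟨fun h => h1 h.2,
        hdown _ h2 _ (Finset.insert_subset_insert _ (Finset.erase_subset _ _))⟩,
        fun h => h1 (h ▸ hv), h2⟩
  · rw [sum_sum_linkVerts hdown (k + 1) (fun ρ x => ∑ v ∈ ρ,
      w (insert x ρ) * g ρ * g (insert x (ρ.erase v)))]
    refine Finset.sum_congr rfl fun σ _ => Finset.sum_congr rfl fun x hx =>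
      Finset.sum_congr rfl fun v hv => ?_
    have hvx := (Finset.mem_erase.1 hv).1
    rw [Finset.insert_erase hx, Finset.erase_right_comm,
      Finset.insert_erase (Finset.mem_erase.2 ⟨hvx.symm, hx⟩)]

section Weights

variable {d : ℕ}

lemma sum_linkVerts_weight
    (hw_rec : ∀ τ ∈ X, τ.card ≤ d →
      w τ = (1 / (τ.card + 1 : ℝ)) *
        ∑ σ ∈ X.filter (fun σ => σ.card = τ.card + 1 ∧ τ ⊆ σ), w σ)
    {τ : Finset V} (hτ : τ ∈ X) (hd : τ.card ≤ d) :
    ∑ v ∈ linkVerts X τ, w (insert v τ) = (τ.card + 1 : ℝ) * w τ := by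
  have hk : (τ.card + 1 : ℝ) ≠ 0 := by positivity
  rw [sum_linkVerts_insert τ w, hw_rec τ hτ hd]
  field_simp

/-- The weighted squares of the values of `f` on the facets of the faces of one dimension. -/
lemma sum_sum_erase
    (hdown : ∀ σ ∈ X, ∀ τ ⊆ σ, τ ∈ X)
    (hw_rec : ∀ τ ∈ X, τ.card ≤ d →
      w τ = (1 / (τ.card + 1 : ℝ)) *
        ∑ σ ∈ X.filter (fun σ => σ.card = τ.card + 1 ∧ τ ⊆ σ), w σ)
    {k : ℕ} (hkd : k ≤ d) (φ : Finset V → ℝ) :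
    ∑ σ ∈ X.filter (fun σ => σ.card = k + 1), ∑ v ∈ σ, w σ * φ (σ.erase v) =
      (k + 1 : ℝ) * ∑ τ ∈ X.filter (fun τ => τ.card = k), w τ * φ τ := by
  have h := sum_sum_linkVerts hdown k (fun τ v => w (insert v τ) * φ τ)
  rw [Finset.mul_sum]
  trans ∑ τ ∈ X.filter (fun τ => τ.card = k), ∑ v ∈ linkVerts X τ, w (insert v τ) * φ τ
  · rw [h]
    refine Finset.sum_congr rfl fun σ _ => Finset.sum_congr rfl fun v hv => ?_
    rw [Finset.insert_erase hv]
  · refine Finset.sum_congr rfl fun τ hτ => ?_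
    obtain ⟨hτ, hc⟩ := Finset.mem_filter.1 hτ
    rw [← Finset.sum_mul, sum_linkVerts_weight hw_rec hτ (hc ▸ hkd), hc]
    ring

/-- The local estimate in a single link, without a mean zero assumption. -/
lemma link_form_le
    (hdown : ∀ σ ∈ X, ∀ τ ⊆ σ, τ ∈ X) (hw_pos : ∀ σ ∈ X, 0 < w σ)
    (hw_rec : ∀ τ ∈ X, τ.card ≤ d →
      w τ = (1 / (τ.card + 1 : ℝ)) *
        ∑ σ ∈ X.filter (fun σ => σ.card = τ.card + 1 ∧ τ ⊆ σ), w σ)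
    {γ : ℝ} (hγ : 0 ≤ γ) {k : ℕ} (hkd : k + 1 ≤ d) {τ : Finset V} (hτ : τ ∈ X)
    (hc : τ.card = k) (hlam : lamTwoLe X w τ γ) (g : Finset V → ℝ) :
    ∑ v ∈ linkVerts X τ, ∑ x ∈ linkVerts X τ,
        (if v ≠ x ∧ insert x (insert v τ) ∈ X then
          w (insert x (insert v τ)) * g (insert v τ) * g (insert x τ) else 0) ≤
      (k + 2 : ℝ) * (γ * ∑ v ∈ linkVerts X τ, w (insert v τ) * g (insert v τ) ^ 2 +
        (k + 1 : ℝ) * (w τ * downAvg X w k g τ ^ 2)) := by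
  set L := linkVerts X τ with hL
  set m := downAvg X w k g τ with hm
  set P : V → V → ℝ := fun v x =>
    if v ≠ x ∧ insert x (insert v τ) ∈ X then w (insert x (insert v τ)) else 0 with hP
  have hk2 : (k + 2 : ℝ) ≠ 0 := by positivity
  have hk1 : (k + 1 : ℝ) ≠ 0 := by positivity
  have hwτ := hw_pos τ hτ
  have hsum : ∑ v ∈ L, w (insert v τ) = (k + 1 : ℝ) * w τ := by
    rw [hL, sum_linkVerts_weight hw_rec hτ (by omega), hc]
  have hmean : ∑ v ∈ L, w (insert v τ) * g (insert v τ) = (k + 1 : ℝ) * w τ * m := by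
    rw [hm, downAvg, ← hL]
    field_simp
  have hPsymm : ∀ v x, P v x = P x v := by
    intro v x
    simp only [hP, Finset.insert_comm x v, ne_comm (a := v)]
  have hPsum : ∀ v ∈ L, ∑ x ∈ L, P v x = (k + 2 : ℝ) * w (insert v τ) := by
    intro v hv
    have hv' := mem_linkVerts.1 hv
    have hcv : (insert v τ).card = k + 1 := by rw [Finset.card_insert_of_notMem hv'.1, hc]
    have h := sum_linkVerts_weight hw_rec hv'.2 (by omega)
    rw [hcv] at h
    push_cast at h
    rw [show (k + 2 : ℝ) = k + 1 + 1 by ring, ← h, hP, ← Finset.sum_filter]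
    refine Finset.sum_congr ?_ fun _ _ => rfl
    ext x
    simp only [hL, Finset.mem_filter, mem_linkVerts, Finset.mem_insert, not_or]
    constructor
    · rintro ⟨⟨h1, h2⟩, h3, h4⟩
      exact ⟨⟨h3.symm, h1⟩, h4⟩
    · rintro ⟨⟨h1, h2⟩, h3⟩
      exact ⟨⟨h2, hdown _ h3 _ (Finset.insert_subset_insert _ (Finset.subset_insert _ _))⟩,
        fun h => h1 h.symm, h3⟩
  have hcross : ∑ v ∈ L, ∑ x ∈ L, P v x * g (insert v τ) =
      (k + 2 : ℝ) * ((k + 1 : ℝ) * w τ * m) := by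
    rw [← hmean, Finset.mul_sum]
    refine Finset.sum_congr rfl fun v hv => ?_
    rw [← Finset.sum_mul, hPsum v hv]
    ring
  have hcross' : ∑ v ∈ L, ∑ x ∈ L, P v x * g (insert x τ) =
      (k + 2 : ℝ) * ((k + 1 : ℝ) * w τ * m) := by
    rw [Finset.sum_comm, ← hcross]
    exact Finset.sum_congr rfl fun v _ => Finset.sum_congr rfl fun x _ => by rw [hPsymm]
  have hPtot : ∑ v ∈ L, ∑ x ∈ L, P v x = (k + 2 : ℝ) * ((k + 1 : ℝ) * w τ) := by
    rw [← hsum, Finset.mul_sum]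
    exact Finset.sum_congr rfl hPsum
  have hzero : ∑ v ∈ L, w (insert v τ) * (g (insert v τ) - m) = 0 := by
    simp only [mul_sub, Finset.sum_sub_distrib, ← Finset.sum_mul]
    rw [hmean, hsum]
    ring
  have hvar : ∑ v ∈ L, w (insert v τ) * (g (insert v τ) - m) ^ 2 =
      ∑ v ∈ L, w (insert v τ) * g (insert v τ) ^ 2 - (k + 1 : ℝ) * (w τ * m ^ 2) := by
    have : ∀ v, w (insert v τ) * (g (insert v τ) - m) ^ 2 = w (insert v τ) * g (insert v τ) ^ 2 -
        w (insert v τ) * g (insert v τ) * (2 * m) + w (insert v τ) * m ^ 2 := fun v => by ring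
    simp only [this, Finset.sum_sub_distrib, Finset.sum_add_distrib, ← Finset.sum_mul]
    rw [hmean, hsum]
    ring
  have hform := hlam (fun v => g (insert v τ) - m) hzero
  have hlhs : (∑ v ∈ L, ∑ x ∈ L,
        if v ≠ x ∧ insert x (insert v τ) ∈ X then
          w (insert v τ) * (w (insert x (insert v τ)) / ((τ.card + 2 : ℝ) * w (insert v τ))) *
            (g (insert v τ) - m) * (g (insert x τ) - m)
        else 0) =
      (1 / (k + 2 : ℝ)) * ∑ v ∈ L, ∑ x ∈ L, P v x * g (insert v τ) * g (insert x τ) -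
        (k + 1 : ℝ) * (w τ * m ^ 2) := by
    trans (1 / (k + 2 : ℝ)) * ∑ v ∈ L, ∑ x ∈ L, (P v x * g (insert v τ) * g (insert x τ) -
        P v x * g (insert v τ) * m - P v x * g (insert x τ) * m + P v x * m ^ 2)
    · rw [Finset.mul_sum]
      refine Finset.sum_congr rfl fun v hv => ?_
      rw [Finset.mul_sum]
      refine Finset.sum_congr rfl fun x _ => ?_
      have hwv := (hw_pos _ (mem_linkVerts.1 hv).2).ne'
      simp only [hP, hc]
      split_ifs
      · field_simp
        ring
      · ring
    · simp only [Finset.sum_sub_distrib, Finset.sum_add_distrib, ← Finset.sum_mul] at hcross ⊢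
      rw [hcross, hcross', hPtot]
      field_simp
      ring
  rw [← hL, hlhs, hvar] at hform
  have hgoal : ∑ v ∈ L, ∑ x ∈ L,
        (if v ≠ x ∧ insert x (insert v τ) ∈ X then
          w (insert x (insert v τ)) * g (insert v τ) * g (insert x τ) else 0) =
      ∑ v ∈ L, ∑ x ∈ L, P v x * g (insert v τ) * g (insert x τ) := by
    refine Finset.sum_congr rfl fun v _ => Finset.sum_congr rfl fun x _ => ?_
    simp only [hP]
    split_ifs <;> ring
  rw [hgoal]
  set Q := ∑ v ∈ L, ∑ x ∈ L, P v x * g (insert v τ) * g (insert x τ)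
  have hQ : Q = (k + 2 : ℝ) * ((1 / (k + 2 : ℝ)) * Q) := by field_simp
  rw [hQ]
  refine mul_le_mul_of_nonneg_left ?_ (by positivity)
  have : 0 ≤ γ * ((k + 1 : ℝ) * (w τ * m ^ 2)) := by positivity
  linarith

/-- The quadratic form of the up-down walk is controlled by the down-up walk on the same faces. -/
lemma up_form_le
    (hdown : ∀ σ ∈ X, ∀ τ ⊆ σ, τ ∈ X) (hw_pos : ∀ σ ∈ X, 0 < w σ)
    (hw_rec : ∀ τ ∈ X, τ.card ≤ d →
      w τ = (1 / (τ.card + 1 : ℝ)) *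
        ∑ σ ∈ X.filter (fun σ => σ.card = τ.card + 1 ∧ τ ⊆ σ), w σ)
    {γ : ℝ} (hγ : 0 ≤ γ) {k : ℕ} (hkd : k + 1 ≤ d)
    (hlam : ∀ τ ∈ X, τ.card = k → lamTwoLe X w τ γ) (g : Finset V → ℝ) :
    ∑ σ ∈ X.filter (fun σ => σ.card = k + 2),
        w σ * ((1 / (k + 2 : ℝ)) * ∑ v ∈ σ, g (σ.erase v)) ^ 2 ≤
      (1 / (k + 2 : ℝ)) * ∑ ρ ∈ X.filter (fun ρ => ρ.card = k + 1), w ρ * g ρ ^ 2 +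
      ((k + 1 : ℝ) / (k + 2)) *
        (γ * ∑ ρ ∈ X.filter (fun ρ => ρ.card = k + 1), w ρ * g ρ ^ 2 +
          ∑ τ ∈ X.filter (fun τ => τ.card = k), w τ * downAvg X w k g τ ^ 2) := by
  have hk2 : (k + 2 : ℝ) ≠ 0 := by positivity
  set N := ∑ ρ ∈ X.filter (fun ρ => ρ.card = k + 1), w ρ * g ρ ^ 2 with hN
  set M := ∑ τ ∈ X.filter (fun τ => τ.card = k), w τ * downAvg X w k g τ ^ 2 with hM
  have hdiag := sum_sum_erase hdown hw_rec hkd (fun ρ => g ρ ^ 2)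
  rw [← hN] at hdiag
  push_cast at hdiag
  have hflag : ∑ τ ∈ X.filter (fun τ => τ.card = k),
      ∑ v ∈ linkVerts X τ, w (insert v τ) * g (insert v τ) ^ 2 = (k + 1 : ℝ) * N := by
    rw [sum_sum_linkVerts hdown k (fun τ v => w (insert v τ) * g (insert v τ) ^ 2), hN,
      Finset.mul_sum]
    refine Finset.sum_congr rfl fun ρ hρ => ?_
    rw [Finset.sum_congr rfl fun v hv => by rw [Finset.insert_erase hv], Finset.sum_const,
      (Finset.mem_filter.1 hρ).2, nsmul_eq_mul]
    push_cast
    ring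
  have hoff : ∑ σ ∈ X.filter (fun σ => σ.card = k + 2), ∑ x ∈ σ, ∑ v ∈ σ.erase x,
        w σ * g (σ.erase x) * g (σ.erase v) ≤
      (k + 2 : ℝ) * (γ * ((k + 1 : ℝ) * N) + (k + 1 : ℝ) * M) := by
    rw [← sum_sum_link_pairs hdown, ← hflag, hM]
    simp only [Finset.mul_sum, ← Finset.sum_add_distrib]
    refine Finset.sum_le_sum fun τ hτ => ?_
    obtain ⟨hτ, hc⟩ := Finset.mem_filter.1 hτ
    have := link_form_le hdown hw_pos hw_rec hγ hkd hτ hc (hlam τ hτ hc) g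
    simpa only [Finset.mul_sum, mul_add] using this
  have hsplit : ∑ σ ∈ X.filter (fun σ => σ.card = k + 2),
        w σ * ((1 / (k + 2 : ℝ)) * ∑ v ∈ σ, g (σ.erase v)) ^ 2 =
      (1 / (k + 2 : ℝ)) ^ 2 *
        (∑ σ ∈ X.filter (fun σ => σ.card = k + 2), ∑ v ∈ σ, w σ * g (σ.erase v) ^ 2 +
        ∑ σ ∈ X.filter (fun σ => σ.card = k + 2), ∑ x ∈ σ, ∑ v ∈ σ.erase x,
          w σ * g (σ.erase x) * g (σ.erase v)) := by
    rw [← Finset.sum_add_distrib, Finset.mul_sum]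
    refine Finset.sum_congr rfl fun σ _ => ?_
    have : ∑ v ∈ σ, w σ * g (σ.erase v) ^ 2 + ∑ x ∈ σ, ∑ v ∈ σ.erase x,
          w σ * g (σ.erase x) * g (σ.erase v) = w σ * (∑ v ∈ σ, g (σ.erase v)) ^ 2 := by
      rw [sq, Finset.sum_mul_sum, Finset.mul_sum, ← Finset.sum_add_distrib]
      refine Finset.sum_congr rfl fun x hx => ?_
      rw [← Finset.add_sum_erase σ _ hx, mul_add, Finset.mul_sum]
      congr 1
      · ring
      · exact Finset.sum_congr rfl fun v _ => by ring
    rw [this]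
    ring
  rw [hsplit, hdiag]
  calc _ ≤ (1 / (k + 2 : ℝ)) ^ 2 * ((k + 1 + 1 : ℝ) * N +
        (k + 2 : ℝ) * (γ * ((k + 1 : ℝ) * N) + (k + 1 : ℝ) * M)) := by gcongr
    _ = _ := by
      field_simp
      ring

/-- Mean zero functions on `X(k)` are contracted by the down operator. -/
lemma sum_downAvg_sq_le
    (hdown : ∀ σ ∈ X, ∀ τ ⊆ σ, τ ∈ X) (hw_pos : ∀ σ ∈ X, 0 < w σ)
    (hw_rec : ∀ τ ∈ X, τ.card ≤ d →
      w τ = (1 / (τ.card + 1 : ℝ)) *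
        ∑ σ ∈ X.filter (fun σ => σ.card = τ.card + 1 ∧ τ ⊆ σ), w σ)
    {γ : ℝ} (hγ : 0 ≤ γ) (hlam : ∀ τ ∈ X, τ.card + 1 ≤ d → lamTwoLe X w τ γ)
    (k : ℕ) (hkd : k ≤ d) (f : Finset V → ℝ)
    (hf : ∑ σ ∈ X.filter (fun σ => σ.card = k + 1), w σ * f σ = 0) :
    ∑ τ ∈ X.filter (fun τ => τ.card = k), w τ * downAvg X w k f τ ^ 2 ≤
      (1 - 1 / ((k : ℝ) + 1) + ((k : ℝ) / 2) * γ) *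
        ∑ σ ∈ X.filter (fun σ => σ.card = k + 1), w σ * f σ ^ 2 := by
  induction k generalizing f with
  | zero =>
    have : ∀ τ ∈ X.filter (fun τ => τ.card = 0), w τ * downAvg X w 0 f τ ^ 2 = 0 := by
      intro τ hτ
      obtain rfl := Finset.card_eq_zero.1 (Finset.mem_filter.1 hτ).2
      have h := sum_linkVerts_insert (X := X) ∅ (fun σ => w σ * f σ)
      simp only [Finset.card_empty, Finset.empty_subset, and_true] at h
      rw [downAvg, h, hf]
      simp
    rw [Finset.sum_eq_zero this]
    simp
  | succ k ih =>
    set g := downAvg X w (k + 1) f with hg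
    set G := ∑ τ ∈ X.filter (fun τ => τ.card = k + 1), w τ * g τ ^ 2 with hG
    set F := ∑ σ ∈ X.filter (fun σ => σ.card = k + 1 + 1), w σ * f σ ^ 2 with hF
    set u : Finset V → ℝ := fun σ => (1 / (k + 2 : ℝ)) * ∑ v ∈ σ, g (σ.erase v) with hu
    set a := 1 - 1 / (((k + 1 : ℕ) : ℝ) + 1) + (((k + 1 : ℕ) : ℝ) / 2) * γ with ha
    have hk2 : ((k + 1 : ℕ) : ℝ) + 1 = k + 2 := by push_cast; ring
    have ha0 : 0 ≤ a := by
      have : 1 / (((k + 1 : ℕ) : ℝ) + 1) ≤ 1 :=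
        (div_le_one (by positivity)).2 (by simp; positivity)
      have : 0 ≤ (((k + 1 : ℕ) : ℝ) / 2) * γ := by positivity
      rw [ha]; linarith
    have hF0 : 0 ≤ F := Finset.sum_nonneg fun σ hσ =>
      mul_nonneg (hw_pos σ (Finset.mem_filter.1 hσ).1).le (sq_nonneg _)
    have hG0 : 0 ≤ G := Finset.sum_nonneg fun σ hσ =>
      mul_nonneg (hw_pos σ (Finset.mem_filter.1 hσ).1).le (sq_nonneg _)
    have hg0 : ∑ τ ∈ X.filter (fun τ => τ.card = k + 1), w τ * g τ = 0 := by
      have h := sum_mul_downAvg_mul hdown hw_pos (k + 1) f (fun _ => 1)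
      simp only [mul_one] at h
      rw [hg, h, ← hf]
      refine Finset.sum_congr rfl fun σ hσ => ?_
      rw [Finset.sum_const, (Finset.mem_filter.1 hσ).2, nsmul_eq_mul]
      push_cast
      field_simp
    have hUp : ∑ σ ∈ X.filter (fun σ => σ.card = k + 1 + 1), w σ * u σ ^ 2 ≤ a * G := by
      refine (up_form_le hdown hw_pos hw_rec hγ hkd
        (fun τ hτ hc => hlam τ hτ (by omega)) g).trans ?_
      have h := ih (by omega) g hg0
      calc _ ≤ (1 / (k + 2 : ℝ)) * G + ((k + 1 : ℝ) / (k + 2)) *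
            (γ * G + (1 - 1 / ((k : ℝ) + 1) + ((k : ℝ) / 2) * γ) * G) := by gcongr
        _ = a * G := by
          rw [ha, hk2]
          push_cast
          field_simp
          ring
    have hadj : G = ∑ σ ∈ X.filter (fun σ => σ.card = k + 1 + 1), w σ * f σ * u σ := by
      have h := sum_mul_downAvg_mul hdown hw_pos (k + 1) f g
      rw [hk2] at h
      rw [hG, ← h]
      exact Finset.sum_congr rfl fun τ _ => by rw [hg]; ring
    have hCS : G ^ 2 ≤ F * ∑ σ ∈ X.filter (fun σ => σ.card = k + 1 + 1), w σ * u σ ^ 2 := by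
      rw [hadj]
      refine Finset.sum_sq_le_sum_mul_sum_of_sq_le_mul _ ?_ ?_ ?_
      · exact fun σ hσ => mul_nonneg (hw_pos σ (Finset.mem_filter.1 hσ).1).le (sq_nonneg _)
      · exact fun σ hσ => mul_nonneg (hw_pos σ (Finset.mem_filter.1 hσ).1).le (sq_nonneg _)
      · exact fun σ _ => le_of_eq (by ring)
    rcases hG0.eq_or_lt with h0 | hpos
    · rw [← h0]
      positivity
    · have : G * G ≤ (a * F) * G := by
        calc G * G = G ^ 2 := by ring
          _ ≤ F * (a * G) := hCS.trans (mul_le_mul_of_nonneg_left hUp hF0)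
          _ = (a * F) * G := by ring
      exact le_of_mul_le_mul_right this hpos

end Weights

end Links

/-- **Rapid mixing of high dimensional random walks, Kaufman–Oppenheim.**
If `(X,w)` is a pure `d`-dimensional weighted simplicial complex which is a `γ`-local
spectral expander, then for every `1 ≤ k ≤ d` the down-up walk `W⁻_k` on `X(k)` satisfies
`λ₂(W⁻_k) ≤ 1 - 1/(k+1) + (k/2)·γ`. -/
theorem rapid_mixing_down_up_walk {V : Type*} [Fintype V] [DecidableEq V] (d : ℕ)
    (X : Finset (Finset V))
    (hdown : ∀ σ ∈ X, ∀ τ ⊆ σ, τ ∈ X)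
    (hpure : ∀ σ ∈ X, (∀ ρ ∈ X, σ ⊆ ρ → σ = ρ) → σ.card = d + 1)
    (w : Finset V → ℝ)
    (hw_pos : ∀ σ ∈ X, 0 < w σ)
    (hw_top : ∑ σ ∈ X.filter (fun σ => σ.card = d + 1), w σ = 1)
    (hw_rec : ∀ τ ∈ X, τ.card ≤ d →
      w τ = (1 / (τ.card + 1 : ℝ)) *
        ∑ σ ∈ X.filter (fun σ => σ.card = τ.card + 1 ∧ τ ⊆ σ), w σ)
    (γ : ℝ) (hγ : 0 ≤ γ)
    (hexp : ∀ τ ∈ X, τ.card + 1 ≤ d → linkConnected X τ ∧ lamTwoLe X w τ γ)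
    (k : ℕ) (hk1 : 1 ≤ k) (hkd : k ≤ d)
    (f : Finset V → ℝ)
    (hf : ∑ σ ∈ X.filter (fun σ => σ.card = k + 1), w σ * f σ = 0) :
    ∑ σ ∈ X.filter (fun σ => σ.card = k + 1), w σ * downUp X w k f σ * f σ ≤
      (1 - 1 / ((k : ℝ) + 1) + ((k : ℝ) / 2) * γ) *
        ∑ σ ∈ X.filter (fun σ => σ.card = k + 1), w σ * f σ ^ 2 := by
  rw [sum_mul_downUp_mul hdown hw_pos]
  exact sum_downAvg_sq_le hdown hw_pos hw_rec hγ (fun τ hτ hd => (hexp τ hτ hd).2) k hkd f hf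
end

section
/- Partition lemma for graphs with the exchange property. Let G = (V,E) be a finite simple graph satisfying the exchange property, and suppose E ≠ ∅. Then there exists a partition of V into three pairwise disjoint sets V₁, V₂, V₃ with V₁ ∪ V₂ ∪ V₃ = V such that: V₁ and V₂ are nonempty; V₁ is an independent set and V₂ is an independent set (no edge of G has both endpoints in V₁, and likewise for V₂); and for all i ≠ j and all u ∈ V_i, v ∈ V_j, the pair {u,v} is an edge of G. -/
/-- **Partition lemma for graphs with the exchange property.**
Let `G` be a finite simple graph satisfying the exchange property, with at least one edge.
Then `V` partitions into `V₁, V₂, V₃` with `V₁, V₂` nonempty independent sets, and all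
pairs of vertices from distinct parts adjacent. -/
theorem exchange_partition_lemma {V : Type*} [Fintype V] (G : SimpleGraph V)
    (hex : ∀ u v x : V, G.Adj v x → G.Adj u v ∨ G.Adj u x)
    (hE : ∃ v x : V, G.Adj v x) :
    ∃ V₁ V₂ V₃ : Set V,
      V₁.Nonempty ∧ V₂.Nonempty ∧
      Disjoint V₁ V₂ ∧ Disjoint V₁ V₃ ∧ Disjoint V₂ V₃ ∧
      V₁ ∪ V₂ ∪ V₃ = Set.univ ∧
      (∀ u ∈ V₁, ∀ v ∈ V₁, ¬ G.Adj u v) ∧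
      (∀ u ∈ V₂, ∀ v ∈ V₂, ¬ G.Adj u v) ∧
      (∀ u ∈ V₁, ∀ v ∈ V₂, G.Adj u v) ∧
      (∀ u ∈ V₁, ∀ v ∈ V₃, G.Adj u v) ∧
      (∀ u ∈ V₂, ∀ v ∈ V₃, G.Adj u v) := by
  obtain ⟨a, b, hab⟩ := hE
  refine ⟨{u | ¬ G.Adj a u}, {u | ¬ G.Adj b u}, {u | G.Adj a u ∧ G.Adj b u},
    ⟨a, G.irrefl⟩, ⟨b, G.irrefl⟩, ?_, ?_, ?_, ?_, ?_, ?_, ?_, ?_, ?_⟩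
  · rw [Set.disjoint_left]
    intro u hu hv
    exact (hex u a b hab).elim (fun h => hu h.symm) (fun h => hv h.symm)
  · exact Set.disjoint_left.2 fun u hu hv => hu hv.1
  · exact Set.disjoint_left.2 fun u hu hv => hu hv.2
  · ext u
    simp only [Set.mem_union, Set.mem_ofPred_eq, Set.mem_univ, iff_true]
    tauto
  · exact fun u hu v hv h => (hex a u v h).elim hu hv
  · exact fun u hu v hv h => (hex b u v h).elim hu hv
  · intro u hu v hv
    have hub : G.Adj u b := (hex u a b hab).resolve_left fun h => hu h.symm
    exact ((hex v u b hub).resolve_right fun h => hv h.symm).symm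
  · intro u hu v hv
    exact ((hex u a v hv.1).resolve_left fun h => hu h.symm)
  · intro u hu v hv
    exact ((hex u b v hv.2).resolve_left fun h => hu h.symm)
end

section
/- Graphs with the exchange property are 0-spectral expanders. Let G = (V,E) be a finite simple graph satisfying the exchange property in which every vertex is contained in at least one edge. Then the second-largest eigenvalue of the simple random walk matrix D⁻¹A is at most 0; equivalently, for every f : V → ℝ with ∑_{v∈V} deg(v)·f(v) = 0, it holds that ∑_{(u,v) : {u,v}∈E, ordered pairs} f(u)·f(v) ≤ 0. -/
open Finset

/-- If `r` is the kernel of a map `c`, then the quadratic form of `r` is nonnegative. -/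
theorem sum_sum_ite_eq_mul_nonneg {V W : Type*} [Fintype V] [Fintype W] [DecidableEq W]
    (c : V → W) (g : V → ℝ) :
    0 ≤ ∑ u : V, ∑ v : V, (if c u = c v then g u * g v else 0) := by
  have h : ∑ u : V, ∑ v : V, (if c u = c v then g u * g v else 0)
      = ∑ s : W, (∑ u : V, if c u = s then g u else 0) ^ 2 := by
    simp_rw [pow_two, Finset.sum_mul_sum]
    rw [Finset.sum_comm (s := (univ : Finset W))]
    refine Finset.sum_congr rfl fun u _ => ?_
    rw [Finset.sum_comm]
    refine Finset.sum_congr rfl fun v _ => ?_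
    simp [mul_ite, eq_comm]
  rw [h]
  positivity

/-- In a graph with the exchange property, two vertices are non-adjacent exactly when they have
the same neighbors. -/
theorem neighborFinset_eq_iff_not_adj {V : Type*} [Fintype V]
    (G : SimpleGraph V) [DecidableRel G.Adj]
    (hex : ∀ u v x : V, G.Adj v x → G.Adj u v ∨ G.Adj u x) (u v : V) :
    G.neighborFinset u = G.neighborFinset v ↔ ¬ G.Adj u v := by
  constructor
  · intro h huv
    have : v ∈ G.neighborFinset u := by simpa using huv
    rw [h] at this
    simp at this
  · intro h
    ext x
    simp only [SimpleGraph.mem_neighborFinset]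
    constructor
    · intro hx
      exact (hex v u x hx).resolve_left fun h' => h h'.symm
    · intro hx
      exact (hex u v x hx).resolve_left h

/-- The adjacency form of a graph with the exchange property is nonpositive on functions
with zero sum. -/
theorem sum_sum_adj_nonpos_of_sum_eq_zero {V : Type*} [Fintype V] [DecidableEq V]
    (G : SimpleGraph V) [DecidableRel G.Adj]
    (hex : ∀ u v x : V, G.Adj v x → G.Adj u v ∨ G.Adj u x)
    (g : V → ℝ) (hg : ∑ v : V, g v = 0) :
    ∑ u : V, ∑ v : V, (if G.Adj u v then g u * g v else 0) ≤ 0 := by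
  have h := sum_sum_ite_eq_mul_nonneg (fun v => G.neighborFinset v) g
  have hsum : ∑ u : V, ∑ v : V, (if G.Adj u v then g u * g v else 0)
      + ∑ u : V, ∑ v : V,
        (if G.neighborFinset u = G.neighborFinset v then g u * g v else 0) = 0 := by
    have hsq : (∑ u : V, g u) * ∑ v : V, g v = 0 := by rw [hg, mul_zero]
    refine Eq.trans ?_ hsq
    rw [Finset.sum_mul_sum, ← Finset.sum_add_distrib]
    refine Finset.sum_congr rfl fun u _ => ?_
    rw [← Finset.sum_add_distrib]
    refine Finset.sum_congr rfl fun v _ => ?_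
    have := neighborFinset_eq_iff_not_adj G hex u v
    by_cases huv : G.Adj u v <;> simp [this, huv]
  linarith

/-- **Graphs with the exchange property are 0-spectral expanders.**
Let `G` be a finite simple graph satisfying the exchange property, with no isolated
vertices.  Then for every `f : V → ℝ` with `∑ v, deg(v)·f(v) = 0` one has
`∑_{ordered pairs (u,v), {u,v}∈E} f(u)·f(v) ≤ 0`; i.e. the second-largest eigenvalue of
the random walk matrix `D⁻¹A` is at most `0`. -/
theorem exchange_zero_spectral_expander {V : Type*} [Fintype V] [DecidableEq V]
    (G : SimpleGraph V) [DecidableRel G.Adj]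
    (hex : ∀ u v x : V, G.Adj v x → G.Adj u v ∨ G.Adj u x)
    (hno_iso : ∀ v : V, ∃ u : V, G.Adj v u)
    (f : V → ℝ)
    (hf : ∑ v : V, (G.degree v : ℝ) * f v = 0) :
    ∑ u : V, ∑ v : V, (if G.Adj u v then f u * f v else 0) ≤ 0 := by
  have hdeg (u : V) : ∑ v : V, (if G.Adj u v then (1 : ℝ) else 0) = G.degree u := by
    simp [← SimpleGraph.card_neighborFinset_eq_degree, SimpleGraph.neighborFinset_eq_filter]
  have hleft : ∑ u : V, ∑ v : V, (if G.Adj u v then f u else 0) = 0 := by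
    refine Eq.trans ?_ hf
    refine Finset.sum_congr rfl fun u _ => ?_
    rw [← hdeg, Finset.sum_mul]
    simp
  have hright : ∑ u : V, ∑ v : V, (if G.Adj u v then f v else 0) = 0 := by
    rw [Finset.sum_comm]
    refine Eq.trans ?_ hleft
    simp_rw [G.adj_comm]
  cases isEmpty_or_nonempty V
  · simp
  set t : ℝ := (∑ v : V, f v) / Fintype.card V with ht
  have hzero : ∑ v : V, (f v - t) = 0 := by
    simp [ht, mul_div_cancel₀]
  have hshift := sum_sum_adj_nonpos_of_sum_eq_zero G hex (fun v => f v - t) hzero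
  have hexpand : ∑ u : V, ∑ v : V, (if G.Adj u v then (f u - t) * (f v - t) else 0)
      = ∑ u : V, ∑ v : V, (if G.Adj u v then f u * f v else 0)
        - t * ∑ u : V, ∑ v : V, (if G.Adj u v then f u else 0)
        - t * ∑ u : V, ∑ v : V, (if G.Adj u v then f v else 0)
        + t ^ 2 * ∑ u : V, ∑ v : V, (if G.Adj u v then 1 else 0) := by
    simp only [Finset.mul_sum, ← Finset.sum_sub_distrib, ← Finset.sum_add_distrib]
    refine Finset.sum_congr rfl fun u _ => Finset.sum_congr rfl fun v _ => ?_
    split_ifs <;> ring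
  have hone : 0 ≤ t ^ 2 * ∑ u : V, ∑ v : V, (if G.Adj u v then (1 : ℝ) else 0) := by
    positivity
  rw [hleft, hright] at hexpand
  linarith
end
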